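/- arXiv:2007.12690 — 3 statements merged into one kernel-verified Lean document; each statement's English description precedes it below -/
import Mathlib

section
/- The sets {123, 2413} and {132, 2314} are forest-Wilf equivalent; that is, for every n ≥ 0 the number of rooted labeled forests on [n] avoiding both patterns 123 and 2413 equals the number of rooted labeled forests on [n] avoiding both patterns 132 and 2314. -/
/-- A rooted labeled forest on `[n]`: vertices are identified with their labels in `Fin n`
(`i : Fin n` representing the label `i+1`), each vertex has an optional parent, and the
parent relation is acyclic. Components are rooted at the vertices with no parent, and
children are unordered since only the parent function is recorded. -/
structure RForest (n : ℕ) where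
  parent : Fin n → Option (Fin n)
  acyclic : ∀ v : Fin n, ¬ Relation.TransGen (fun a b => parent b = some a) v v

namespace RForest

variable {n : ℕ}

/-- `u` is a strict ancestor of `v`. -/
def SAnc (F : RForest n) (u v : Fin n) : Prop :=
  Relation.TransGen (fun a b => F.parent b = some a) u v

/-- `u` is an ancestor of `v` (possibly `u = v`). -/
def Anc (F : RForest n) (u v : Fin n) : Prop :=
  F.SAnc u v ∨ u = v

/-- `F` is a tree: it has exactly one root, i.e. exactly one component. -/
def IsTree (F : RForest n) : Prop :=
  ∃! r : Fin n, F.parent r = none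

end RForest

/-- A pattern of length `k` is a permutation of `[k]` (presented 0-indexed on `Fin k`). -/
abbrev Pattern (k : ℕ) := Equiv.Perm (Fin k)

/-- The complement of a pattern: `π̄(i) = k + 1 - π(i)` in 1-indexed terms. -/
def Pattern.compl {k : ℕ} (π : Pattern k) : Pattern k :=
  π.trans ⟨Fin.rev, Fin.rev, Fin.rev_rev, Fin.rev_rev⟩

/-- `F` contains a (classical) instance of the pattern `π`: vertices `v 0, …, v (k-1)`,
each a strict ancestor of the next, whose labels are in the same relative order as `π`. -/
def ContainsPat {n k : ℕ} (F : RForest n) (π : Pattern k) : Prop :=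
  ∃ v : Fin k → Fin n,
    (∀ i j : Fin k, i < j → F.SAnc (v i) (v j)) ∧
    (∀ i j : Fin k, v i < v j ↔ π i < π j)

/-- `v` is a consecutive instance of `π` in `F`: a downward path (each vertex the parent of
the next) whose labels are in the same relative order as `π`. -/
def IsConsInstance {n k : ℕ} (F : RForest n) (π : Pattern k) (v : Fin k → Fin n) : Prop :=
  (∀ i j : Fin k, (j : ℕ) = (i : ℕ) + 1 → F.parent (v j) = some (v i)) ∧
  (∀ i j : Fin k, v i < v j ↔ π i < π j)

/-- `F` contains a consecutive instance of `π`. -/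
def CContainsPat {n k : ℕ} (F : RForest n) (π : Pattern k) : Prop :=
  ∃ v, IsConsInstance F π v

/-- `F` avoids every pattern in the set `S` (of patterns of arbitrary lengths). -/
def AvoidsSet {n : ℕ} (F : RForest n) (S : Set ((k : ℕ) × Pattern k)) : Prop :=
  ∀ p ∈ S, ¬ ContainsPat F p.2

/-- `f_n(S)`: the number of rooted labeled forests on `[n]` avoiding `S`. -/
noncomputable def fCount (S : Set ((k : ℕ) × Pattern k)) (n : ℕ) : ℕ :=
  Nat.card {F : RForest n // AvoidsSet F S}

/-- `t_n(S)`: the number of rooted labeled trees on `[n]` avoiding `S`. -/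
noncomputable def tCount (S : Set ((k : ℕ) × Pattern k)) (n : ℕ) : ℕ :=
  Nat.card {F : RForest n // F.IsTree ∧ AvoidsSet F S}

/-- The number of rooted labeled forests on `[n]` consecutively avoiding `π`. -/
noncomputable def cCount {k : ℕ} (π : Pattern k) (n : ℕ) : ℕ :=
  Nat.card {F : RForest n // ¬ CContainsPat F π}

/-- c-forest-Wilf equivalence of two patterns. -/
def CForestWilfEquiv {k k' : ℕ} (π : Pattern k) (π' : Pattern k') : Prop :=
  ∀ n : ℕ, cCount π n = cCount π' n

def p123 : Pattern 3 := 1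
def p132 : Pattern 3 := ⟨![0, 2, 1], ![0, 2, 1], by intro x; fin_cases x <;> rfl, by intro x; fin_cases x <;> rfl⟩
def p213 : Pattern 3 := ⟨![1, 0, 2], ![1, 0, 2], by intro x; fin_cases x <;> rfl, by intro x; fin_cases x <;> rfl⟩
def p231 : Pattern 3 := ⟨![1, 2, 0], ![2, 0, 1], by intro x; fin_cases x <;> rfl, by intro x; fin_cases x <;> rfl⟩
def p312 : Pattern 3 := ⟨![2, 0, 1], ![1, 2, 0], by intro x; fin_cases x <;> rfl, by intro x; fin_cases x <;> rfl⟩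
def p321 : Pattern 3 := ⟨![2, 1, 0], ![2, 1, 0], by intro x; fin_cases x <;> rfl, by intro x; fin_cases x <;> rfl⟩
def p2413 : Pattern 4 := ⟨![1, 3, 0, 2], ![2, 0, 3, 1], by intro x; fin_cases x <;> rfl, by intro x; fin_cases x <;> rfl⟩
def p2314 : Pattern 4 := ⟨![1, 2, 0, 3], ![2, 0, 1, 3], by intro x; fin_cases x <;> rfl, by intro x; fin_cases x <;> rfl⟩
def p3142 : Pattern 4 := ⟨![2, 0, 3, 1], ![1, 3, 0, 2], by intro x; fin_cases x <;> rfl, by intro x; fin_cases x <;> rfl⟩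
def p3124 : Pattern 4 := ⟨![2, 0, 1, 3], ![1, 2, 0, 3], by intro x; fin_cases x <;> rfl, by intro x; fin_cases x <;> rfl⟩

/-- The strict ancestor relation of a forest: a strict partial order in which the strict
ancestors of every vertex are pairwise comparable. -/
structure IsForestOrder {α : Type*} (r : α → α → Prop) : Prop where
  irrefl : ∀ a, ¬ r a a
  trans : ∀ {a b c}, r a b → r b c → r a c
  chain : ∀ {a b c}, r a c → r b c → r a b ∨ a = b ∨ r b a

section Rotation

variable {β : Type*} [LinearOrder β]

theorem exists_cyclicShift (S : Finset β) : ∃ ρ : Equiv.Perm β,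
    (∀ x ∉ S, ρ x = x) ∧ (∀ x ∈ S, ρ x ∈ S) ∧
    (∀ x ∈ S, ∀ y ∈ S, x < y → (∃ z ∈ S, y < z) → ρ x < ρ y) ∧
    (∀ x ∈ S, (∀ z ∈ S, z ≤ x) → ∀ z ∈ S, ρ x ≤ z) := by
  classical
  obtain hk | ⟨k, hk⟩ : S.card = 0 ∨ ∃ k, S.card = k + 1 := by
    cases S.card <;> simp
  · rw [Finset.card_eq_zero] at hk
    subst hk
    exact ⟨1, by simp, by simp, by simp, by simp⟩
  let e := S.orderIsoOfFin hk
  let τ : Equiv.Perm S := e.toEquiv.permCongr (finRotate (k + 1))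
  have hτ (x : β) (hx : x ∈ S) :
      Equiv.Perm.ofSubtype τ x = e (finRotate (k + 1) (e.symm ⟨x, hx⟩)) := by
    rw [Equiv.Perm.ofSubtype_apply_of_mem τ hx]
    rfl
  refine ⟨Equiv.Perm.ofSubtype τ, fun x hx => Equiv.Perm.ofSubtype_apply_of_not_mem τ hx,
    fun x hx => ?_, ?_, ?_⟩
  · rw [hτ x hx]
    exact Subtype.coe_prop _
  · rintro x hx y hy hxy ⟨z, hz, hyz⟩
    have h₁ : e.symm ⟨x, hx⟩ < e.symm ⟨y, hy⟩ := e.symm.strictMono hxy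
    have h₂ : e.symm ⟨y, hy⟩ < e.symm ⟨z, hz⟩ := e.symm.strictMono hyz
    rw [hτ x hx, hτ y hy, Subtype.coe_lt_coe, e.lt_iff_lt, Fin.lt_def,
      coe_finRotate_of_ne_last, coe_finRotate_of_ne_last]
    · simpa using h₁
    · exact (h₂.trans_le (Fin.le_last _)).ne
    · exact (h₁.trans (h₂.trans_le (Fin.le_last _))).ne
  · intro x hx hmax z hz
    have h : e.symm ⟨x, hx⟩ = Fin.last k := by
      rw [e.symm_apply_eq]
      exact le_antisymm (e.symm_apply_le.1 (Fin.le_last _)) (hmax _ (Subtype.coe_prop _))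
    rw [hτ x hx, h, finRotate_last]
    exact e.le_symm_apply.1 (Fin.zero_le (e.symm ⟨z, hz⟩))

/-- A permutation sending each element of `S` to the next one, the largest to the smallest, and
fixing all elements outside `S`. -/
noncomputable def cyclicShift (S : Finset β) : Equiv.Perm β :=
  (exists_cyclicShift S).choose

variable {S : Finset β} {x y : β}

theorem cyclicShift_of_notMem (hx : x ∉ S) : cyclicShift S x = x :=
  (exists_cyclicShift S).choose_spec.1 x hx

theorem cyclicShift_mem (hx : x ∈ S) : cyclicShift S x ∈ S :=
  (exists_cyclicShift S).choose_spec.2.1 x hx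

theorem cyclicShift_lt (hx : x ∈ S) (hy : y ∈ S) (hxy : x < y) (h : ∃ z ∈ S, y < z) :
    cyclicShift S x < cyclicShift S y :=
  (exists_cyclicShift S).choose_spec.2.2.1 x hx y hy hxy h

theorem cyclicShift_max_le (hx : x ∈ S) (h : ∀ z ∈ S, z ≤ x) (hy : y ∈ S) : cyclicShift S x ≤ y :=
  (exists_cyclicShift S).choose_spec.2.2.2 x hx h y hy

theorem cyclicShift_symm_of_notMem (hx : x ∉ S) : (cyclicShift S).symm x = x := by
  rw [Equiv.symm_apply_eq, cyclicShift_of_notMem hx]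

theorem cyclicShift_symm_mem (hx : x ∈ S) : (cyclicShift S).symm x ∈ S := by
  by_contra h
  have := cyclicShift_of_notMem h
  rw [Equiv.apply_symm_apply] at this
  exact h (this ▸ hx)

theorem cyclicShift_symm_lt (hx : x ∈ S) (hy : y ∈ S) (hxy : x < y) (h : ∃ z ∈ S, z < x) :
    (cyclicShift S).symm x < (cyclicShift S).symm y := by
  have hx' := cyclicShift_symm_mem hx
  have hy' := cyclicShift_symm_mem hy
  by_contra! hle
  have hne : (cyclicShift S).symm y ≠ (cyclicShift S).symm x := by simpa using hxy.ne'
  by_cases hm : ∀ z ∈ S, z ≤ (cyclicShift S).symm x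
  · obtain ⟨z, hz, hzx⟩ := h
    have := cyclicShift_max_le hx' hm hz
    rw [Equiv.apply_symm_apply] at this
    exact absurd hzx this.not_gt
  · push Not at hm
    have := cyclicShift_lt hy' hx' (lt_of_le_of_ne hle hne) hm
    rw [Equiv.apply_symm_apply, Equiv.apply_symm_apply] at this
    exact absurd hxy this.not_gt

theorem le_cyclicShift_symm_min (hx : x ∈ S) (h : ∀ z ∈ S, x ≤ z) (hy : y ∈ S) :
    y ≤ (cyclicShift S).symm x := by
  have hm := S.max'_mem ⟨x, hx⟩
  have : cyclicShift S (S.max' ⟨x, hx⟩) = x :=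
    le_antisymm (cyclicShift_max_le hm (fun z hz => S.le_max' z hz) hx) (h _ (cyclicShift_mem hm))
  rw [← this, Equiv.symm_apply_apply]
  exact S.le_max' y hy

end Rotation

section Labelings

variable {α β : Type*} [LinearOrder β] {r : α → α → Prop} {v : α}

/-- `u` is the middle vertex of a chain `a, u, w` whose first label is the smallest and whose last
two labels are related by `p`. -/
def HasChain (r : α → α → Prop) (p : β → β → Prop) (f : α → β) (u : α) : Prop :=
  ∃ a w, r a u ∧ r u w ∧ f a < f u ∧ f a < f w ∧ p (f u) (f w)

/-- A chain `a, b, c, w` with `f c < f a < f b, f w`, where `a` has the least label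
among all strict ancestors of `b`. -/
def HasDip (r : α → α → Prop) (f : α → β) : Prop :=
  ∃ a b c w, r a b ∧ r b c ∧ r c w ∧ f c < f a ∧ f a < f b ∧ f a < f w ∧ ∀ a', r a' b → f a ≤ f a'

/-- The vertices `u` of the subtree at `v` such that `u` and `v` both exceed the label of a common
strict ancestor of `v`. -/
def upper (r : α → α → Prop) (v : α) (f : α → β) : Set α :=
  {u | (u = v ∨ r v u) ∧ ∃ a, r a v ∧ f a < f v ∧ f a < f u}

/-- `g` arises from `f` by permuting the labels on `upper r v f`, preserving the relative order
on the strict descendants of `v`. -/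
structure IsRearrangement (r : α → α → Prop) (v : α) (f g : α → β) : Prop where
  eq_of_notMem : ∀ u ∉ upper r v f, g u = f u
  exists_eq : ∀ u ∈ upper r v f, ∃ u' ∈ upper r v f, g u = f u'
  exists_eq' : ∀ u ∈ upper r v f, ∃ u' ∈ upper r v f, f u = g u'
  lt : ∀ x ∈ upper r v f, ∀ y ∈ upper r v f, x ≠ v → y ≠ v → f x < f y → g x < g y

theorem exists_ancestor_min [Finite α] (f : α → β) {a b : α} (h : r a b) :
    ∃ a₀, r a₀ b ∧ ∀ a', r a' b → f a₀ ≤ f a' :=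
  Set.exists_min_image {x | r x b} f (Set.toFinite _) ⟨a, h⟩

theorem exists_mem_upper_iff [Finite α] (f : α → β) (h : (upper r v f).Nonempty) :
    ∃ m, r m v ∧ f m < f v ∧ (∀ a, r a v → f m ≤ f a) ∧
      ∀ u, u ∈ upper r v f ↔ (u = v ∨ r v u) ∧ f m < f u := by
  obtain ⟨_, _, a, hav, hlt, _⟩ := h
  obtain ⟨m, hm, hmin⟩ := exists_ancestor_min f hav
  have hmv := (hmin a hav).trans_lt hlt
  exact ⟨m, hm, hmv, hmin, fun u => ⟨fun ⟨hu, a', ha', _, h'⟩ => ⟨hu, (hmin a' ha').trans_lt h'⟩,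
    fun ⟨hu, h'⟩ => ⟨hu, m, hm, hmv, h'⟩⟩⟩

namespace IsRearrangement

variable {f g : α → β}

theorem eq_of_not_le (h : IsRearrangement r v f g) {u : α} (hu : ¬ (u = v ∨ r v u)) : g u = f u :=
  h.eq_of_notMem u fun h' => hu h'.1

theorem eq_of_rel (hr : IsForestOrder r) (h : IsRearrangement r v f g) {u : α} (hu : r u v) :
    g u = f u :=
  h.eq_of_not_le fun h' => h'.elim (fun e => hr.irrefl v (e ▸ hu))
    fun h' => hr.irrefl v (hr.trans h' hu)

theorem upper_eq [Finite α] (hr : IsForestOrder r) (h : IsRearrangement r v f g) :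
    upper r v g = upper r v f := by
  obtain hne | hne := (upper r v f).eq_empty_or_nonempty
  · have : g = f := funext fun u => h.eq_of_notMem u (by simp [hne])
    rw [this]
  obtain ⟨m, hm, hmv, hmin, hmem⟩ := exists_mem_upper_iff f hne
  have key (u) (hu : u ∈ upper r v f) : f m < g u := by
    obtain ⟨u', hu', e⟩ := h.exists_eq u hu
    rw [e]
    exact ((hmem u').1 hu').2
  have hgv := key v ((hmem v).2 ⟨Or.inl rfl, hmv⟩)
  ext u
  constructor
  · rintro ⟨hu, a, ha, -, hau⟩
    rw [h.eq_of_rel hr ha] at hau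
    by_contra hcon
    rw [h.eq_of_notMem u hcon] at hau
    exact hcon ((hmem u).2 ⟨hu, (hmin a ha).trans_lt hau⟩)
  · intro hu
    exact ⟨hu.1, m, hm, by rwa [h.eq_of_rel hr hm], by
      rw [h.eq_of_rel hr hm]; exact key u hu⟩

theorem symm [Finite α] (hr : IsForestOrder r) (hf : f.Injective) (h : IsRearrangement r v f g) :
    IsRearrangement r v g f where
  eq_of_notMem u hu := (h.eq_of_notMem u (h.upper_eq hr ▸ hu)).symm
  exists_eq u hu := by
    rw [h.upper_eq hr] at hu ⊢
    exact h.exists_eq' u hu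
  exists_eq' u hu := by
    rw [h.upper_eq hr] at hu ⊢
    exact h.exists_eq u hu
  lt x hx y hy hxv hyv hxy := by
    rw [h.upper_eq hr] at hx hy
    by_contra! hle
    obtain e | hlt := hle.eq_or_lt
    · exact hxy.ne (congrArg g (hf e)).symm
    · exact hxy.not_gt (h.lt y hy x hx hyv hxv hlt)

theorem lt_of_lt [Finite α] (hr : IsForestOrder r) (h : IsRearrangement r v f g) {x y : α}
    (hx : r v x) (hy : r v y) (hxy : f x < f y) : g x < g y := by
  obtain hne | hne := (upper r v f).eq_empty_or_nonempty
  · rwa [h.eq_of_notMem x (by simp [hne]), h.eq_of_notMem y (by simp [hne])]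
  obtain ⟨m, hm, hmv, hmin, hmem⟩ := exists_mem_upper_iff f hne
  have ne_v {z} (hz : r v z) : z ≠ v := fun e => hr.irrefl v (e ▸ hz)
  by_cases hxu : x ∈ upper r v f
  · have hyu : y ∈ upper r v f := (hmem y).2 ⟨Or.inr hy, ((hmem x).1 hxu).2.trans hxy⟩
    exact h.lt x hxu y hyu (ne_v hx) (ne_v hy) hxy
  · rw [h.eq_of_notMem x hxu]
    by_cases hyu : y ∈ upper r v f
    · obtain ⟨y', hy', e⟩ := h.exists_eq y hyu
      rw [e]
      have hxm : ¬ f m < f x := fun hlt => hxu ((hmem x).2 ⟨Or.inr hx, hlt⟩)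
      exact (not_lt.1 hxm).trans_lt ((hmem y').1 hy').2
    · rwa [h.eq_of_notMem y hyu]

/-- Either nothing changes or the change can be described in terms of a strict ancestor `m` of `v`
with minimal label. -/
theorem eq_or_exists_min [Finite α] (hr : IsForestOrder r) (h : IsRearrangement r v f g) :
    f = g ∨ ∃ m, r m v ∧ g m = f m ∧ f m < f v ∧ f m < g v ∧ (∀ a, r a v → g m ≤ g a) ∧
      (∀ u, ¬ f m < g u → g u = f u) ∧
      (∀ u, (u = v ∨ r v u) → g u = f u ∨ ∃ u', (u' = v ∨ r v u') ∧ g u = f u') ∧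
      (∀ u, f m < g u → f m < f u) := by
  obtain hne | hne := (upper r v f).eq_empty_or_nonempty
  · exact Or.inl (funext fun u => (h.eq_of_notMem u (by simp [hne])).symm)
  obtain ⟨m, hm, hmv, hmin, hmem⟩ := exists_mem_upper_iff f hne
  have key (u) (hu : u ∈ upper r v f) : f m < g u := by
    obtain ⟨u', hu', e⟩ := h.exists_eq u hu
    rw [e]
    exact ((hmem u').1 hu').2
  have hgm := h.eq_of_rel hr hm
  refine Or.inr ⟨m, hm, hgm, hmv, key v ((hmem v).2 ⟨Or.inl rfl, hmv⟩), ?_, ?_, ?_, ?_⟩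
  · intro a ha
    rw [hgm, h.eq_of_rel hr ha]
    exact hmin a ha
  · intro u hu
    exact h.eq_of_notMem u fun h' => hu (key u h')
  · intro u hu
    by_cases hmu : u ∈ upper r v f
    · obtain ⟨u', hu', e⟩ := h.exists_eq u hmu
      exact Or.inr ⟨u', hu'.1, e⟩
    · exact Or.inl (h.eq_of_notMem u hmu)
  · intro u hlt
    by_cases hmu : u ∈ upper r v f
    · exact ((hmem u).1 hmu).2
    · rwa [← h.eq_of_notMem u hmu]

theorem hasChain_of_hasChain [Finite α] (hr : IsForestOrder r) (hf : f.Injective)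
    (h : IsRearrangement r v f g) {p : β → β → Prop} (hp : p = (· < ·) ∨ p = (· > ·)) {u : α}
    (hu : u ≠ v) (hg : HasChain r p g u) : HasChain r p f u := by
  obtain rfl | ⟨m, hm, hgm, hmv, hmgv, hmin, heq, hex, hgt⟩ := h.eq_or_exists_min hr
  · exact hg
  have hlt {x y} (hx : r v x) (hy : r v y) (hxy : p (g x) (g y)) : p (f x) (f y) := by
    obtain rfl | rfl := hp
    · exact (h.symm hr hf).lt_of_lt hr hx hy hxy
    · exact (h.symm hr hf).lt_of_lt hr hy hx hxy
  obtain ⟨a, w, hau, huw, h₁, h₂, h₃⟩ := hg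
  have hmu_chain (hmu : r m u) (hvu : r v u) (hlu : f m < g u) (hlw : f m < g w) :
      HasChain r p f u :=
    ⟨m, w, hmu, huw, hgt u hlu, hgt w hlw,
      hlt hvu (hr.trans hvu huw) h₃⟩
  by_cases hvw : w = v ∨ r v w
  swap
  · have hvu : ¬ (u = v ∨ r v u) := by
      rintro (rfl | h')
      · exact hvw (Or.inr huw)
      · exact hvw (Or.inr (hr.trans h' huw))
    have hva : ¬ (a = v ∨ r v a) := by
      rintro (rfl | h')
      · exact hvu (Or.inr hau)
      · exact hvu (Or.inr (hr.trans h' hau))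
    rw [h.eq_of_not_le hvu, h.eq_of_not_le hvw] at h₃
    rw [h.eq_of_not_le hva, h.eq_of_not_le hvw] at h₂
    rw [h.eq_of_not_le hva, h.eq_of_not_le hvu] at h₁
    exact ⟨a, w, hau, huw, h₁, h₂, h₃⟩
  have huv : r u v ∨ r v u := by
    obtain rfl | hvw := hvw
    · exact Or.inl huw
    · exact (hr.chain huw hvw).imp_right fun h' => h'.resolve_left hu
  obtain huv | hvu := huv
  · have ea := h.eq_of_rel hr (hr.trans hau huv)
    have eu := h.eq_of_rel hr huv
    rw [ea] at h₁ h₂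
    rw [eu] at h₁ h₃
    obtain e | ⟨w', hw', e⟩ := hex w hvw <;> rw [e] at h₂ h₃
    · exact ⟨a, w, hau, huw, h₁, h₂, h₃⟩
    · refine ⟨a, w', hau, ?_, h₁, h₂, h₃⟩
      obtain rfl | hw' := hw'
      · exact huv
      · exact hr.trans huv hw'
  · have hmu := hr.trans hm hvu
    obtain hav | rfl | hva := hr.chain hau hvu
    · by_cases hlu : f m < g u
      · by_cases hlw : f m < g w
        · exact hmu_chain hmu hvu hlu hlw
        · have := hmin a hav
          rw [hgm] at this
          exact absurd (this.trans_lt h₂) hlw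
      · have := hmin a hav
        rw [hgm] at this
        exact absurd (this.trans_lt h₁) hlu
    · exact hmu_chain hmu hvu (hmgv.trans h₁) (hmgv.trans h₂)
    · exact ⟨a, w, hau, huw, (h.symm hr hf).lt_of_lt hr hva hvu h₁,
        (h.symm hr hf).lt_of_lt hr hva (hr.trans hvu huw) h₂, hlt hvu (hr.trans hvu huw) h₃⟩

theorem hasDip_of_hasDip [Finite α] (hr : IsForestOrder r)
    (h : IsRearrangement r v f g) (hg : HasDip r g) : HasDip r f := by
  obtain rfl | ⟨m, hm, hgm, hmv, hmgv, hmin, heq, hex, hgt⟩ := h.eq_or_exists_min hr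
  · exact hg
  obtain ⟨a, b, c, w, hab, hbc, hcw, hca, hab', haw, ha⟩ := hg
  by_cases hma : g a ≤ f m
  · have ea := heq a hma.not_gt
    have hlt {x} (hx : g a < g x) : f a < f x := by
      by_cases hx' : f m < g x
      · exact (ea ▸ hma).trans_lt (hgt x hx')
      · rwa [← ea, ← heq x hx']
    refine ⟨a, b, c, w, hab, hbc, hcw, ?_, hlt hab', hlt haw, fun a' ha' => ?_⟩
    · rwa [← ea, ← heq c (hca.trans_le hma).not_gt]
    · by_cases hx' : f m < g a'
      · exact (ea ▸ hma).trans (hgt a' hx').le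
      · rw [← ea, ← heq a' hx']
        exact ha a' ha'
  rw [not_le] at hma
  by_cases hvw : w = v ∨ r v w
  · have hbv : r b v := by
      have hmb : ¬ r m b := fun hmb => (hgm ▸ hma).not_ge (ha m hmb)
      obtain rfl | hvw := hvw
      · exact hr.trans hbc hcw
      · obtain hbv | rfl | hvb := hr.chain (hr.trans hbc hcw) hvw
        · exact hbv
        · exact absurd hm hmb
        · exact absurd (hr.trans hm hvb) hmb
    have hbm : r b m := by
      obtain hbm | rfl | hmb := hr.chain hbv hm
      · exact hbm
      · exact absurd hab' (hgm ▸ hma).not_gt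
      · exact absurd (ha m hmb) (hgm ▸ hma).not_ge
    have ea := h.eq_of_rel hr (hr.trans hab hbv)
    have eb := h.eq_of_rel hr hbv
    have ha_min (a') (ha' : r a' b) : f a ≤ f a' := by
      have := ha a' ha'
      rwa [ea, h.eq_of_rel hr (hr.trans ha' hbv)] at this
    have hmu {u} (hu : u = v ∨ r v u) : r m u := by
      obtain rfl | hu := hu
      · exact hm
      · exact hr.trans hm hu
    rw [ea, eb] at hab'
    rw [ea] at haw hma
    obtain e | ⟨w', hw', e⟩ := hex w hvw <;> rw [e] at haw
    · exact ⟨a, b, m, w, hab, hbm, hmu hvw, hma, hab', haw, ha_min⟩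
    · exact ⟨a, b, m, w', hab, hbm, hmu hw', hma, hab', haw, ha_min⟩
  · have hnot {x y} (hxy : r x y) (hy : ¬ (y = v ∨ r v y)) : ¬ (x = v ∨ r v x) := by
      rintro (rfl | h')
      · exact hy (Or.inr hxy)
      · exact hy (Or.inr (hr.trans h' hxy))
    have hvc := hnot hcw hvw
    have hvb := hnot hbc hvc
    have ea := h.eq_of_not_le (hnot hab hvb)
    rw [ea, h.eq_of_not_le hvc] at hca
    rw [ea, h.eq_of_not_le hvb] at hab'
    rw [ea, h.eq_of_not_le hvw] at haw
    refine ⟨a, b, c, w, hab, hbc, hcw, hca, hab', haw, fun a' ha' => ?_⟩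
    have := ha a' ha'
    rwa [ea, h.eq_of_not_le (hnot ha' hvb)] at this

end IsRearrangement

variable (r v) in
/-- The labels on `upper r v f`. -/
noncomputable def upperLabels [Finite α] (f : α → β) : Finset β :=
  ((upper r v f).toFinite.image f).toFinset

theorem mem_upperLabels [Finite α] {f : α → β} (hf : f.Injective) {u : α} :
    f u ∈ upperLabels r v f ↔ u ∈ upper r v f := by
  simp [upperLabels, hf.eq_iff]

theorem exists_of_mem_upperLabels [Finite α] {f : α → β} {x : β} (hx : x ∈ upperLabels r v f) :
    ∃ u ∈ upper r v f, f u = x := by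
  simpa [upperLabels] using hx

theorem IsRearrangement.upperLabels_eq [Finite α] {f g : α → β} (hr : IsForestOrder r)
    (h : IsRearrangement r v f g) : upperLabels r v g = upperLabels r v f := by
  ext x
  simp only [upperLabels, h.upper_eq hr, Set.Finite.mem_toFinset, Set.mem_image]
  constructor
  · rintro ⟨u, hu, rfl⟩
    obtain ⟨u', hu', e⟩ := h.exists_eq u hu
    exact ⟨u', hu', e.symm⟩
  · rintro ⟨u, hu, rfl⟩
    obtain ⟨u', hu', e⟩ := h.exists_eq' u hu
    exact ⟨u', hu', e.symm⟩

theorem isRearrangement_perm [Finite α] {f : α → β} (hf : f.Injective) (ρ : Equiv.Perm β)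
    (hfix : ∀ x ∉ upperLabels r v f, ρ x = x)
    (hmem : ∀ x ∈ upperLabels r v f, ρ x ∈ upperLabels r v f)
    (hmem' : ∀ x ∈ upperLabels r v f, ρ.symm x ∈ upperLabels r v f)
    (hlt : ∀ x ∈ upper r v f, ∀ y ∈ upper r v f, x ≠ v → y ≠ v → f x < f y →
      ρ (f x) < ρ (f y)) : IsRearrangement r v f (ρ ∘ f) where
  eq_of_notMem u hu := hfix _ (by rwa [mem_upperLabels hf])
  exists_eq u hu := by
    obtain ⟨u', hu', e⟩ := exists_of_mem_upperLabels (hmem _ ((mem_upperLabels hf).2 hu))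
    exact ⟨u', hu', e.symm⟩
  exists_eq' u hu := by
    obtain ⟨u', hu', e⟩ := exists_of_mem_upperLabels (hmem' _ ((mem_upperLabels hf).2 hu))
    exact ⟨u', hu', by simp [e]⟩
  lt := hlt

theorem mem_upper_of_hasChain {f : α → β} {p : β → β → Prop} (h : HasChain r p f v) :
    v ∈ upper r v f ∧ ∃ w ∈ upper r v f, p (f v) (f w) := by
  obtain ⟨a, w, hav, hvw, h₁, h₂, h₃⟩ := h
  exact ⟨⟨Or.inl rfl, a, hav, h₁, h₁⟩, w, ⟨Or.inr hvw, a, hav, h₁, h₂⟩, h₃⟩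

theorem not_of_not_hasChain {f : α → β} {p : β → β → Prop} (h : ¬ HasChain r p f v) {u : α}
    (hu : u ∈ upper r v f) (huv : u ≠ v) : ¬ p (f v) (f u) := by
  obtain ⟨hvu, a, ha, h₁, h₂⟩ := hu
  exact fun hp => h ⟨a, u, ha, hvu.resolve_left huv, h₁, h₂, hp⟩

theorem mem_upper_self {f : α → β} {u : α} (hu : u ∈ upper r v f) : v ∈ upper r v f := by
  obtain ⟨_, a, ha, h, _⟩ := hu
  exact ⟨Or.inl rfl, a, ha, h, h⟩

section Shift

variable [Finite α] {f : α → β}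

theorem le_of_not_hasChain_lt (h : ¬ HasChain r (· < ·) f v) {x : β}
    (hx : x ∈ upperLabels r v f) : x ≤ f v := by
  obtain ⟨u, hu, rfl⟩ := exists_of_mem_upperLabels hx
  by_cases huv : u = v
  · rw [huv]
  · exact not_lt.1 (not_of_not_hasChain h hu huv)

theorem le_of_not_hasChain_gt (h : ¬ HasChain r (· > ·) f v) {x : β}
    (hx : x ∈ upperLabels r v f) : f v ≤ x := by
  obtain ⟨u, hu, rfl⟩ := exists_of_mem_upperLabels hx
  by_cases huv : u = v
  · rw [huv]
  · exact not_lt.1 (not_of_not_hasChain h hu huv)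

theorem isRearrangement_cyclicShift (hf : f.Injective) (h : ¬ HasChain r (· < ·) f v) :
    IsRearrangement r v f (cyclicShift (upperLabels r v f) ∘ f) := by
  refine isRearrangement_perm hf _ (fun _ => cyclicShift_of_notMem) (fun _ => cyclicShift_mem)
    (fun _ => cyclicShift_symm_mem) fun x hx y hy _ hyv hxy => ?_
  have hy' := (mem_upperLabels hf).2 hy
  exact cyclicShift_lt ((mem_upperLabels hf).2 hx) hy' hxy ⟨f v,
    (mem_upperLabels hf).2 (mem_upper_self hx),
    (le_of_not_hasChain_lt h hy').lt_of_ne (hf.ne hyv)⟩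

theorem isRearrangement_cyclicShift_symm (hf : f.Injective) (h : ¬ HasChain r (· > ·) f v) :
    IsRearrangement r v f ((cyclicShift (upperLabels r v f)).symm ∘ f) := by
  refine isRearrangement_perm hf _ (fun _ => cyclicShift_symm_of_notMem)
    (fun _ => cyclicShift_symm_mem) (fun _ => cyclicShift_mem) fun x hx y hy hxv _ hxy => ?_
  have hx' := (mem_upperLabels hf).2 hx
  exact cyclicShift_symm_lt hx' ((mem_upperLabels hf).2 hy) hxy ⟨f v,
    (mem_upperLabels hf).2 (mem_upper_self hx),
    (le_of_not_hasChain_gt h hx').lt_of_ne (hf.ne hxv.symm)⟩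

theorem not_hasChain_gt_cyclicShift (hr : IsForestOrder r) (hf : f.Injective)
    (h : ¬ HasChain r (· < ·) f v) :
    ¬ HasChain r (· > ·) (cyclicShift (upperLabels r v f) ∘ f) v := by
  intro hc
  obtain ⟨hv, w, hw, hlt⟩ := mem_upper_of_hasChain hc
  rw [(isRearrangement_cyclicShift hf h).upper_eq hr] at hv hw
  exact (cyclicShift_max_le ((mem_upperLabels hf).2 hv) (fun _ => le_of_not_hasChain_lt h)
    (cyclicShift_mem ((mem_upperLabels hf).2 hw))).not_gt hlt

theorem not_hasChain_lt_cyclicShift_symm (hr : IsForestOrder r) (hf : f.Injective)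
    (h : ¬ HasChain r (· > ·) f v) :
    ¬ HasChain r (· < ·) ((cyclicShift (upperLabels r v f)).symm ∘ f) v := by
  intro hc
  obtain ⟨hv, w, hw, hlt⟩ := mem_upper_of_hasChain hc
  rw [(isRearrangement_cyclicShift_symm hf h).upper_eq hr] at hv hw
  exact (le_cyclicShift_symm_min ((mem_upperLabels hf).2 hv) (fun _ => le_of_not_hasChain_gt h)
    (cyclicShift_symm_mem ((mem_upperLabels hf).2 hw))).not_gt hlt

end Shift

/-- Avoidance of `HasDip`, of decreasing chains at the vertices in `T`, and of increasing chains at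
the vertices outside `T`. -/
def AvoidsWith (r : α → α → Prop) (T : Set α) (f : α → β) : Prop :=
  ¬ HasDip r f ∧ (∀ u ∈ T, ¬ HasChain r (· > ·) f u) ∧ ∀ u ∉ T, ¬ HasChain r (· < ·) f u

theorem AvoidsWith.cyclicShift [Finite α] (hr : IsForestOrder r) {T : Set α} (hv : v ∉ T)
    {f : α → β} (hf : f.Injective) (h : AvoidsWith r T f) :
    AvoidsWith r (insert v T) (cyclicShift (upperLabels r v f) ∘ f) := by
  obtain ⟨h₁, h₂, h₃⟩ := h
  have hrel := isRearrangement_cyclicShift hf (h₃ v hv)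
  refine ⟨fun hd => h₁ (hrel.hasDip_of_hasDip hr hd), ?_, ?_⟩
  · rintro u (rfl | hu)
    · exact not_hasChain_gt_cyclicShift hr hf (h₃ u hv)
    · exact fun hc => h₂ u hu
        (hrel.hasChain_of_hasChain hr hf (Or.inr rfl) (fun e => hv (e ▸ hu)) hc)
  · intro u hu hc
    rw [Set.mem_insert_iff, not_or] at hu
    exact h₃ u hu.2 (hrel.hasChain_of_hasChain hr hf (Or.inl rfl) hu.1 hc)

theorem AvoidsWith.cyclicShift_symm [Finite α] (hr : IsForestOrder r) {T : Set α} (hv : v ∉ T)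
    {f : α → β} (hf : f.Injective) (h : AvoidsWith r (insert v T) f) :
    AvoidsWith r T ((_root_.cyclicShift (upperLabels r v f)).symm ∘ f) := by
  obtain ⟨h₁, h₂, h₃⟩ := h
  have hvc := h₂ v (Set.mem_insert v T)
  have hrel := isRearrangement_cyclicShift_symm hf hvc
  refine ⟨fun hd => h₁ (hrel.hasDip_of_hasDip hr hd), fun u hu hc => ?_, fun u hu => ?_⟩
  · exact h₂ u (Set.mem_insert_of_mem v hu)
      (hrel.hasChain_of_hasChain hr hf (Or.inr rfl) (fun e => hv (e ▸ hu)) hc)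
  · by_cases huv : u = v
    · subst huv
      exact not_hasChain_lt_cyclicShift_symm hr hf hvc
    · exact fun hc => h₃ u (by simp [huv, hu])
        (hrel.hasChain_of_hasChain hr hf (Or.inl rfl) huv hc)

/-- Shifting the labels in the subtree at `v` turns avoidance of increasing chains at `v` into
avoidance of decreasing ones. -/
noncomputable def avoidsWithInsertEquiv [Finite α] (hr : IsForestOrder r) {T : Set α}
    (hv : v ∉ T) :
    {σ : α ≃ β // AvoidsWith r T σ} ≃ {σ : α ≃ β // AvoidsWith r (insert v T) σ} where
  toFun σ := ⟨σ.1.trans (cyclicShift (upperLabels r v σ.1)),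
    σ.2.cyclicShift hr hv σ.1.injective⟩
  invFun σ := ⟨σ.1.trans (cyclicShift (upperLabels r v σ.1)).symm,
    σ.2.cyclicShift_symm hr hv σ.1.injective⟩
  left_inv σ := by
    have := (isRearrangement_cyclicShift σ.1.injective (σ.2.2.2 v hv)).upperLabels_eq hr
    ext u
    simp only [Equiv.coe_trans, this]
    simp
  right_inv σ := by
    have := (isRearrangement_cyclicShift_symm σ.1.injective
      (σ.2.2.1 v (Set.mem_insert v T))).upperLabels_eq hr
    ext u
    simp only [Equiv.coe_trans, this]
    simp

theorem nonempty_avoidsWith_equiv [Finite α] (hr : IsForestOrder r) (T : Set α) :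
    Nonempty ({σ : α ≃ β // AvoidsWith r ∅ σ} ≃ {σ : α ≃ β // AvoidsWith r T σ}) := by
  induction T, T.toFinite using Set.Finite.induction_on with
  | empty => exact ⟨Equiv.refl _⟩
  | insert hv _ ih => exact ih.map fun e => e.trans (avoidsWithInsertEquiv hr hv)

end Labelings

namespace RForest

variable {n : ℕ}

theorem isForestOrder_sAnc (F : RForest n) : IsForestOrder F.SAnc where
  irrefl := F.acyclic
  trans := Relation.TransGen.trans
  chain {a b c} ha hb := by
    have hu : Relator.RightUnique (Function.swap fun a b => F.parent b = some a) :=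
      fun x y z h h' => Option.some_injective _ (h.symm.trans h')
    have := Relation.ReflTransGen.total_of_right_unique hu
      (Relation.reflTransGen_swap.2 ha.to_reflTransGen)
      (Relation.reflTransGen_swap.2 hb.to_reflTransGen)
    obtain h | h := this.imp Relation.reflTransGen_swap.1 Relation.reflTransGen_swap.1
    · exact Or.inr ((Relation.reflTransGen_iff_eq_or_transGen.1 h).imp_left fun e => e)
    · obtain e | h := Relation.reflTransGen_iff_eq_or_transGen.1 h
      exacts [Or.inr (Or.inl e.symm), Or.inl h]

/-- The forest obtained by renaming the vertices along `σ`. -/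
def rename (σ : Equiv.Perm (Fin n)) (F : RForest n) : RForest n where
  parent x := (F.parent (σ.symm x)).map σ
  acyclic x h := F.acyclic (σ.symm x) <| h.lift σ.symm fun a b hab => by
    obtain ⟨c, hc, rfl⟩ := Option.map_eq_some_iff.1 hab
    simpa [Function.onFun] using hc

theorem sAnc_rename (σ : Equiv.Perm (Fin n)) (F : RForest n) {x y : Fin n} :
    (F.rename σ).SAnc x y ↔ F.SAnc (σ.symm x) (σ.symm y) := by
  constructor
  · refine fun h => h.lift σ.symm fun a b hab => ?_
    obtain ⟨c, hc, rfl⟩ := Option.map_eq_some_iff.1 hab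
    simpa [Function.onFun] using hc
  · intro h
    have : (F.rename σ).SAnc (σ (σ.symm x)) (σ (σ.symm y)) :=
      h.lift σ fun a b hab => by simp [rename, Function.onFun, hab]
    simpa using this

/-- Renaming vertices as a permutation of the set of forests. -/
def renameEquiv (σ : Equiv.Perm (Fin n)) : RForest n ≃ RForest n where
  toFun := rename σ
  invFun := rename σ.symm
  left_inv F := by cases F; simp [rename, Function.comp_def]
  right_inv F := by cases F; simp [rename, Function.comp_def]

theorem containsPat_rename {k : ℕ} (σ : Equiv.Perm (Fin n)) (F : RForest n) (π : Pattern k) :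
    ContainsPat (F.rename σ) π ↔ ∃ v : Fin k → Fin n,
      (∀ i j, i < j → F.SAnc (v i) (v j)) ∧ StrictMono (σ ∘ v ∘ π.symm) := by
  have hmono (v : Fin k → Fin n) :
      (∀ i j, σ (v i) < σ (v j) ↔ π i < π j) ↔ StrictMono (σ ∘ v ∘ π.symm) := by
    refine ⟨fun h i j hij => (h _ _).2 (by simpa using hij), fun h i j => ?_⟩
    simpa using h.lt_iff_lt (a := π i) (b := π j)
  simp only [ContainsPat, sAnc_rename, ← hmono]
  constructor
  · rintro ⟨v, h₁, h₂⟩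
    exact ⟨σ.symm ∘ v, h₁, by simpa using h₂⟩
  · rintro ⟨v, h₁, h₂⟩
    exact ⟨σ ∘ v, by simpa using h₁, h₂⟩

variable {σ : Equiv.Perm (Fin n)} {F : RForest n}

theorem containsPat_rename_three (π : Pattern 3) : ContainsPat (F.rename σ) π ↔
    ∃ a b c, F.SAnc a b ∧ F.SAnc b c ∧ StrictMono (σ ∘ ![a, b, c] ∘ π.symm) := by
  rw [containsPat_rename]
  constructor
  · rintro ⟨v, h, hm⟩
    refine ⟨v 0, v 1, v 2, h _ _ (by simp), h _ _ (by simp), ?_⟩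
    convert hm
    ext i
    fin_cases i <;> rfl
  · rintro ⟨a, b, c, hab, hbc, hm⟩
    refine ⟨_, ?_, hm⟩
    have := F.isForestOrder_sAnc.trans hab hbc
    simp [Fin.forall_fin_succ, *]

theorem containsPat_rename_four (π : Pattern 4) : ContainsPat (F.rename σ) π ↔
    ∃ a b c d, F.SAnc a b ∧ F.SAnc b c ∧ F.SAnc c d ∧
      StrictMono (σ ∘ ![a, b, c, d] ∘ π.symm) := by
  rw [containsPat_rename]
  constructor
  · rintro ⟨v, h, hm⟩
    refine ⟨v 0, v 1, v 2, v 3, h _ _ (by simp), h _ _ (by simp), h _ _ (by simp), ?_⟩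
    convert hm
    ext i
    fin_cases i <;> rfl
  · rintro ⟨a, b, c, d, hab, hbc, hcd, hm⟩
    refine ⟨_, ?_, hm⟩
    have h₁ := F.isForestOrder_sAnc.trans hab hbc
    have h₂ := F.isForestOrder_sAnc.trans hbc hcd
    have h₃ := F.isForestOrder_sAnc.trans h₁ hcd
    simp [Fin.forall_fin_succ, *]

theorem containsPat_rename_p123 :
    ContainsPat (F.rename σ) p123 ↔ ∃ u, HasChain F.SAnc (· < ·) σ u := by
  rw [containsPat_rename_three]
  simp only [Fin.strictMono_iff_lt_succ, p123]
  constructor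
  · rintro ⟨a, b, c, hab, hbc, h⟩
    have h₀ := h 0
    have h₁ := h 1
    exact ⟨b, a, c, hab, hbc, h₀, h₀.trans h₁, h₁⟩
  · rintro ⟨b, a, c, hab, hbc, h₀, -, h₁⟩
    exact ⟨a, b, c, hab, hbc, Fin.forall_fin_two.2 ⟨h₀, h₁⟩⟩

theorem containsPat_rename_p132 :
    ContainsPat (F.rename σ) p132 ↔ ∃ u, HasChain F.SAnc (· > ·) σ u := by
  rw [containsPat_rename_three]
  simp only [Fin.strictMono_iff_lt_succ, p132]
  constructor
  · rintro ⟨a, b, c, hab, hbc, h⟩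
    have h₀ := h 0
    have h₁ := h 1
    exact ⟨b, a, c, hab, hbc, h₀.trans h₁, h₀, h₁⟩
  · rintro ⟨b, a, c, hab, hbc, -, h₀, h₁⟩
    exact ⟨a, b, c, hab, hbc, Fin.forall_fin_two.2 ⟨h₀, h₁⟩⟩

theorem containsPat_rename_p2413 : ContainsPat (F.rename σ) p2413 ↔
    ∃ a b c d, F.SAnc a b ∧ F.SAnc b c ∧ F.SAnc c d ∧ σ c < σ a ∧ σ a < σ d ∧ σ d < σ b := by
  rw [containsPat_rename_four]
  simp only [Fin.strictMono_iff_lt_succ, p2413, Fin.forall_fin_succ, IsEmpty.forall_iff, and_true]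
  rfl

theorem containsPat_rename_p2314 : ContainsPat (F.rename σ) p2314 ↔
    ∃ a b c d, F.SAnc a b ∧ F.SAnc b c ∧ F.SAnc c d ∧ σ c < σ a ∧ σ a < σ b ∧ σ b < σ d := by
  rw [containsPat_rename_four]
  simp only [Fin.strictMono_iff_lt_succ, p2314, Fin.forall_fin_succ, IsEmpty.forall_iff, and_true]
  rfl

theorem avoidsWith_empty_iff : AvoidsWith F.SAnc ∅ σ ↔
    ¬ ContainsPat (F.rename σ) p123 ∧ ¬ ContainsPat (F.rename σ) p2413 := by
  have hr := F.isForestOrder_sAnc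
  simp only [AvoidsWith, containsPat_rename_p123, containsPat_rename_p2413, not_exists,
    Set.mem_empty_iff_false, false_imp_iff, implies_true, true_and, not_false_eq_true, true_imp_iff]
  simp only [← not_exists]
  rw [and_comm]
  refine and_congr_right fun hc => not_congr ⟨?_, ?_⟩
  · rintro ⟨a, b, c, w, hab, hbc, hcw, hca, hb, hw, -⟩
    have hbw := hr.trans hbc hcw
    refine ⟨a, b, c, w, hab, hbc, hcw, hca, hw, (not_lt.1 fun h => hc ?_).lt_of_ne ?_⟩
    · exact ⟨b, a, w, hab, hbw, hb, hw, h⟩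
    · exact fun e => hr.irrefl b (σ.injective e ▸ hbw)
  · rintro ⟨a, b, c, w, hab, hbc, hcw, hca, haw, hwb⟩
    obtain ⟨a₀, ha₀, hmin⟩ := exists_ancestor_min σ hab
    have h₀ := hmin a hab
    have ha₀c := hr.trans ha₀ hbc
    refine ⟨a₀, b, c, w, ha₀, hbc, hcw, (not_lt.1 fun h => hc ?_).lt_of_ne ?_,
      h₀.trans_lt (haw.trans hwb), h₀.trans_lt haw, hmin⟩
    · exact ⟨c, a₀, w, ha₀c, hcw, h, h₀.trans_lt haw, hca.trans haw⟩
    · exact fun e => hr.irrefl c (σ.injective e ▸ ha₀c)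

theorem avoidsWith_univ_iff : AvoidsWith F.SAnc Set.univ σ ↔
    ¬ ContainsPat (F.rename σ) p132 ∧ ¬ ContainsPat (F.rename σ) p2314 := by
  have hr := F.isForestOrder_sAnc
  simp only [AvoidsWith, containsPat_rename_p132, containsPat_rename_p2314, not_exists,
    Set.mem_univ, not_true, false_imp_iff, implies_true, and_true, true_imp_iff]
  simp only [← not_exists]
  rw [and_comm]
  refine and_congr_right fun hc => not_congr ⟨?_, ?_⟩
  · rintro ⟨a, b, c, w, hab, hbc, hcw, hca, hb, hw, -⟩
    have hbw := hr.trans hbc hcw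
    refine ⟨a, b, c, w, hab, hbc, hcw, hca, hb, (not_lt.1 fun h => hc ?_).lt_of_ne ?_⟩
    · exact ⟨b, a, w, hab, hbw, hb, hw, h⟩
    · exact fun e => hr.irrefl b (by simpa [← σ.injective e] using hbw)
  · rintro ⟨a, b, c, w, hab, hbc, hcw, hca, hab', hbw⟩
    obtain ⟨a₀, ha₀, hmin⟩ := exists_ancestor_min σ hab
    have h₀ := hmin a hab
    have ha₀c := hr.trans ha₀ hbc
    refine ⟨a₀, b, c, w, ha₀, hbc, hcw, (not_lt.1 fun h => hc ?_).lt_of_ne ?_,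
      h₀.trans_lt hab', h₀.trans_lt (hab'.trans hbw), hmin⟩
    · exact ⟨b, a₀, c, ha₀, hbc, h₀.trans_lt hab', h, hca.trans hab'⟩
    · exact fun e => hr.irrefl c (σ.injective e ▸ ha₀c)

/-- Pairs of a forest and a renaming of its vertices to a forest satisfying `P` correspond to pairs
of a permutation and a forest satisfying `P`. -/
def sigmaRenameEquiv (P : RForest n → Prop) :
    (Σ F : RForest n, {σ : Equiv.Perm (Fin n) // P (F.rename σ)}) ≃
      Equiv.Perm (Fin n) × {F : RForest n // P F} where
  toFun x := (x.2.1, ⟨x.1.rename x.2.1, x.2.2⟩)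
  invFun y := ⟨(renameEquiv y.1).symm y.2.1, y.1, by
    have : rename y.1 ((renameEquiv y.1).symm y.2.1) = y.2.1 :=
      (renameEquiv y.1).apply_symm_apply y.2.1
    rw [this]
    exact y.2.2⟩
  left_inv := by
    rintro ⟨F, σ, h⟩
    have e : (renameEquiv σ).symm (F.rename σ) = F := (renameEquiv σ).symm_apply_apply F
    refine Sigma.ext e ?_
    simp only
    congr! 1
    rw [e]
  right_inv := by
    rintro ⟨σ, F, h⟩
    exact Prod.ext rfl (Subtype.ext ((renameEquiv σ).apply_symm_apply F))

theorem card_congr_of_rename {P Q : RForest n → Prop}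
    (h : ∀ F : RForest n, Nonempty ({σ : Equiv.Perm (Fin n) // P (F.rename σ)} ≃
      {σ : Equiv.Perm (Fin n) // Q (F.rename σ)})) :
    Nat.card {F // P F} = Nat.card {F // Q F} := by
  have e := Nat.card_congr ((sigmaRenameEquiv P).symm.trans
    ((Equiv.sigmaCongrRight fun F => (h F).some).trans (sigmaRenameEquiv Q)))
  rw [Nat.card_prod, Nat.card_prod] at e
  exact Nat.eq_of_mul_eq_mul_left Nat.card_pos e

end RForest

/-- The sets `{123, 2413}` and `{132, 2314}` are forest-Wilf equivalent. -/
theorem forestWilf_123_2413_eq_132_2314 :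
    ∀ n : ℕ,
      Nat.card {F : RForest n // ¬ ContainsPat F p123 ∧ ¬ ContainsPat F p2413} =
      Nat.card {F : RForest n // ¬ ContainsPat F p132 ∧ ¬ ContainsPat F p2314} := by
  intro n
  refine RForest.card_congr_of_rename fun F => ?_
  simp only [← RForest.avoidsWith_empty_iff, ← RForest.avoidsWith_univ_iff]
  exact nonempty_avoidsWith_equiv F.isForestOrder_sAnc Set.univ
end

section
/- Let π = π(1)⋯π(k) be a pattern of length k ≥ 3 satisfying π(k) = π(k−1) + 1 = π(k−2) + 2, and let π̃ = π(1)⋯π(k−2) π(k) π(k−1) be its twist. Then the sets {213, π} and {213, π̃} are forest-Wilf equivalent. -/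
namespace RForest

variable {n : ℕ}

theorem SAnc.trans {F : RForest n} {a b c : Fin n} (h : F.SAnc a b) (h' : F.SAnc b c) :
    F.SAnc a c :=
  Relation.TransGen.trans h h'

theorem SAnc.ne {F : RForest n} {a b : Fin n} (h : F.SAnc a b) : a ≠ b := by
  rintro rfl
  exact F.acyclic _ h

theorem SAnc.asymm {F : RForest n} {a b : Fin n} (h : F.SAnc a b) : ¬ F.SAnc b a :=
  fun h' => F.acyclic _ (h.trans h')

/-- The strict ancestors of a vertex form a chain. -/
theorem SAnc.trichotomy {F : RForest n} {a b c : Fin n} (ha : F.SAnc a c) (hb : F.SAnc b c) :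
    a = b ∨ F.SAnc a b ∨ F.SAnc b a := by
  induction ha with
  | single h =>
    rcases Relation.TransGen.tail'_iff.1 hb with ⟨d, hd, hdc⟩
    have : d = a := Option.some.inj (hdc.symm.trans h)
    subst this
    rcases Relation.reflTransGen_iff_eq_or_transGen.1 hd with h | h
    · exact Or.inl h
    · exact Or.inr (Or.inr h)
  | tail hab h ih =>
    rcases Relation.TransGen.tail'_iff.1 hb with ⟨d, hd, hdc⟩
    have := Option.some.inj (hdc.symm.trans h)
    subst this
    rcases Relation.reflTransGen_iff_eq_or_transGen.1 hd with h | h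
    · subst h
      exact Or.inr (Or.inl hab)
    · exact ih h

/-- Transport a forest along a permutation of its labels. -/
def transport (τ : Equiv.Perm (Fin n)) (F : RForest n) : RForest n where
  parent v := (F.parent (τ.symm v)).map τ
  acyclic v h := by
    refine F.acyclic (τ.symm v) (Relation.TransGen.lift τ.symm (fun a b hab => ?_) _ _ h)
    obtain ⟨c, hc, rfl⟩ := Option.map_eq_some_iff.1 hab
    simpa [Function.onFun] using hc

theorem sAnc_transport {τ : Equiv.Perm (Fin n)} {F : RForest n} {a b : Fin n} :
    (F.transport τ).SAnc (τ a) (τ b) ↔ F.SAnc a b := by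
  constructor
  · intro h
    have := Relation.TransGen.lift (p := fun a b => F.parent b = some a) τ.symm
      (fun a b hab => ?_) _ _ h
    · simpa [Function.onFun, SAnc] using this
    · obtain ⟨c, hc, rfl⟩ := Option.map_eq_some_iff.1 hab
      simpa [Function.onFun] using hc
  · intro h
    exact Relation.TransGen.lift τ (fun a b hab => by simp [Function.onFun, transport, hab]) _ _ h

/-- `F` avoids `213`. -/
def Avoids213 (F : RForest n) : Prop :=
  ∀ a b c, F.SAnc a b → F.SAnc b c → b < a → ¬ a < c

theorem not_containsPat_p213 {F : RForest n} : ¬ ContainsPat F p213 ↔ F.Avoids213 := by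
  constructor
  · intro h a b c hab hbc hba hac
    refine h ⟨![a, b, c], ?_, ?_⟩
    · intro i j hij
      fin_cases i <;> fin_cases j <;> simp_all
      exact hab.trans hbc
    · intro i j
      have hbc' := hba.trans hac
      fin_cases i <;> fin_cases j <;>
        simp [p213, hba, hac, hbc', hba.le, hac.le, hbc'.le]
  · rintro h ⟨v, hv, hv'⟩
    exact h (v 0) (v 1) (v 2) (hv 0 1 (by decide)) (hv 1 2 (by decide))
      ((hv' 1 0).2 (by decide)) ((hv' 0 2).2 (by decide))

open Classical in
/-- The descendants of `x` with label greater than `x`. -/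
noncomputable def upper (F : RForest n) (x : Fin n) : Finset (Fin n) :=
  Finset.univ.filter fun y => F.SAnc x y ∧ x < y

theorem mem_upper {F : RForest n} {x y : Fin n} : y ∈ F.upper x ↔ F.SAnc x y ∧ x < y := by
  simp [upper]

/-- `v 0, …, v m` is a chain ending at `x` in the same relative order as `p 0, …, p m`. -/
def IsInstance (F : RForest n) (p : ℕ → ℕ) (m : ℕ) (x : Fin n) (v : ℕ → Fin n) : Prop :=
  v m = x ∧ ∀ a b, a < b → b ≤ m → F.SAnc (v a) (v b) ∧ (v a < v b ↔ p a < p b)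

/-- `x` is the last vertex of an instance of `p 0, …, p m`. -/
def Marked (F : RForest n) (p : ℕ → ℕ) (m : ℕ) (x : Fin n) : Prop :=
  ∃ v, F.IsInstance p m x v

theorem lt_iff_of_mem_upper {F : RForest n} (hF : F.Avoids213) {a i y : Fin n}
    (ha : F.SAnc a i) (hy : y ∈ F.upper i) : a < y ↔ a < i := by
  rw [mem_upper] at hy
  constructor
  · intro h
    by_contra h'
    exact hF a i y ha hy.1 (lt_of_le_of_ne (not_lt.1 h') ha.ne.symm) h
  · exact fun h => h.trans hy.2

theorem lt_of_notMem_upper {F : RForest n} {i y : Fin n}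
    (hy : F.SAnc i y) (h : y ∉ F.upper i) : y < i := by
  rw [mem_upper, not_and] at h
  exact lt_of_le_of_ne (not_lt.1 (h hy)) hy.ne.symm

section Instances

variable {F : RForest n} {p : ℕ → ℕ} {m : ℕ} {x : Fin n} {v : ℕ → Fin n}

theorem IsInstance.lt_of_lt_last (hF : F.Avoids213) (hv : F.IsInstance p m x v) {a b : ℕ}
    (hab : a < b) (hb : b ≤ m) (ha : p a < p m) : v a < v b := by
  rcases hb.eq_or_lt with rfl | hb'
  · exact (hv.2 a b hab le_rfl).2.2 ha
  · by_contra h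
    have h1 := hv.2 a b hab hb
    have h2 := hv.2 b m hb' le_rfl
    have h3 := hv.2 a m (hab.trans hb') le_rfl
    exact hF _ _ _ h1.1 h2.1 (lt_of_le_of_ne (not_lt.1 h) h1.1.ne.symm) (h3.2.2 ha)

theorem IsInstance.not_lt_of_last_lt (hF : F.Avoids213) (hv : F.IsInstance p m x v) {a b c : ℕ}
    (hac : a < c) (hcb : c < b) (hb : b ≤ m) (h : p c < p a) : ¬ p a < p b := by
  intro h'
  have h1 := hv.2 a c hac (hcb.le.trans hb)
  have h2 := hv.2 c b hcb hb
  have h3 := hv.2 a b (hac.trans hcb) hb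
  refine hF _ _ _ h1.1 h2.1 (lt_of_le_of_ne (not_lt.1 fun h4 => ?_) h1.1.ne.symm) (h3.2.2 h')
  exact absurd (h1.2.1 h4) (by omega)

theorem exists_cut (p : ℕ → ℕ) (m j : ℕ) (hj : j < m) (hp : ∀ l < m, p l ≠ p m)
    (hpj : p m < p j) :
    ∃ c, j < c ∧ c ≤ m ∧ p c ≤ p m ∧ ((∀ l < c, p m < p l) ∨
      ∃ r < j, p r < p m ∧ ∀ l, r < l → l < c → p m < p l) := by
  classical
  have hex : ∃ c, j < c ∧ p c ≤ p m := ⟨m, hj, le_rfl⟩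
  obtain ⟨hc1, hc2⟩ := Nat.find_spec hex
  have hcm : Nat.find hex ≤ m := Nat.find_min' hex ⟨hj, le_rfl⟩
  have hmid : ∀ l, j < l → l < Nat.find hex → p m < p l := fun l h1 h2 => by
    have := Nat.find_min hex h2
    by_contra h
    exact this ⟨h1, by omega⟩
  refine ⟨Nat.find hex, hc1, hcm, hc2, ?_⟩
  have key : ∀ d ≤ j, (∀ l < d, p m < p l) ∨
      ∃ r < d, p r < p m ∧ ∀ l, r < l → l < d → p m < p l := by
    intro d
    induction d with
    | zero => exact fun _ => Or.inl fun l h => by omega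
    | succ d ih =>
      intro hd
      rcases lt_or_gt_of_ne (hp d (by omega)) with h | h
      · exact Or.inr ⟨d, by omega, h, fun l h1 h2 => by omega⟩
      · rcases ih (by omega) with ih | ⟨r, hr, hr1, hr2⟩
        · refine Or.inl fun l hl => ?_
          rcases Nat.lt_succ_iff_lt_or_eq.1 hl with hl | rfl
          · exact ih l hl
          · exact h
        · refine Or.inr ⟨r, by omega, hr1, fun l h1 hl => ?_⟩
          rcases Nat.lt_succ_iff_lt_or_eq.1 hl with hl | rfl
          · exact hr2 l h1 hl
          · exact h
  have hext : ∀ l, j ≤ l → l < Nat.find hex → p m < p l := fun l h1 h2 => by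
    rcases h1.eq_or_lt with rfl | h1
    · exact hpj
    · exact hmid l h1 h2
  rcases key j le_rfl with h | ⟨r, hr, hr1, hr2⟩
  · refine Or.inl fun l hl => ?_
    rcases lt_or_ge l j with h' | h'
    · exact h l h'
    · exact hext l h' hl
  · refine Or.inr ⟨r, hr, hr1, fun l h1 hl => ?_⟩
    rcases lt_or_ge l j with h' | h'
    · exact hr2 l h1 h'
    · exact hext l h' hl

/-- The last vertex of an instance may be replaced by any vertex of its `upper` set. -/
theorem IsInstance.of_mem_upper (hF : F.Avoids213) {i : Fin n} (hv : F.IsInstance p m i v)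
    (hx : x ∈ F.upper i) : F.IsInstance p m x fun l => if l < m then v l else x := by
  refine ⟨by simp, fun a b hab hb => ?_⟩
  have ha : a < m := by omega
  rcases hb.eq_or_lt with rfl | hb
  · obtain ⟨h1, h2⟩ := hv.2 a b ha le_rfl
    rw [hv.1] at h1 h2
    simp only [ha, if_true, lt_irrefl, if_false]
    exact ⟨h1.trans (mem_upper.1 hx).1, (lt_iff_of_mem_upper hF h1 hx).trans h2⟩
  · simp only [ha, hb, if_true]
    exact hv.2 a b hab hb.le

/-- If `i` and `x` are marked, then `x` ends an instance with no earlier vertex in `upper i`. -/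
theorem IsInstance.exists_notMem_upper (hF : F.Avoids213) (hp : ∀ l < m, p l ≠ p m)
    {i : Fin n} {s t : ℕ → Fin n} (hs : F.IsInstance p m x s) (ht : F.IsInstance p m i t) :
    ∃ u, F.IsInstance p m x u ∧ ∀ l < m, u l ∉ F.upper i := by
  by_cases hex : ∃ j < m, s j ∈ F.upper i
  swap
  · push Not at hex
    exact ⟨s, hs, hex⟩
  obtain ⟨j, hj, hsj⟩ := hex
  have hti : ∀ l < m, F.SAnc (t l) i := fun l hl => ht.1 ▸ (ht.2 l m hl le_rfl).1
  have htlt : ∀ l < m, (t l < i ↔ p l < p m) := fun l hl => ht.1 ▸ (ht.2 l m hl le_rfl).2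
  have htu : ∀ l < m, t l ∉ F.upper i := fun l hl h =>
    (hti l hl).asymm (mem_upper.1 h).1
  have hsx : ∀ l < m, F.SAnc (s l) x := fun l hl => hs.1 ▸ (hs.2 l m hl le_rfl).1
  have hslt : ∀ l < m, (s l < x ↔ p l < p m) := fun l hl => hs.1 ▸ (hs.2 l m hl le_rfl).2
  by_cases hx : x ∈ F.upper i
  · exact ⟨_, ht.of_mem_upper hF hx, fun l hl => by simpa [hl] using htu l hl⟩
  obtain ⟨hij, hij'⟩ := mem_upper.1 hsj
  have hix : F.SAnc i x := hij.trans (hsx j hj)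
  have hxi : x < i := lt_of_notMem_upper hix hx
  have hpj : p m < p j := by
    have := (hslt j hj).not.1 (not_lt.2 (hxi.trans hij').le)
    have := hp j hj
    omega
  have htgt : ∀ l < m, p m < p l → i < t l := fun l hl h =>
    lt_of_le_of_ne (not_lt.1 ((htlt l hl).not.2 (by omega))) (hti l hl).ne.symm
  obtain ⟨c, hjc, hcm, hpc, hcut⟩ := exists_cut p m j hj hp hpj
  have hscx : s c ≤ x := by
    rcases hcm.eq_or_lt with rfl | h
    · exact hs.1.le
    · exact ((hslt c h).2 (lt_of_le_of_ne hpc (hp c h))).le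
  have hisc : ∀ b, c ≤ b → b ≤ m → F.SAnc i (s b) := fun b hcb hb =>
    hij.trans (hs.2 j b (by omega) hb).1
  have hsbi : ∀ b, c ≤ b → b ≤ m → s b < i := fun b hcb hb => by
    rcases hcb.eq_or_lt with rfl | hcb
    · exact hscx.trans_lt hxi
    · exact lt_of_le_of_ne (not_lt.1 (hF i (s c) (s b) (hisc c le_rfl hcm) (hs.2 c b hcb hb).1
        (hscx.trans_lt hxi))) (hisc b hcb.le hb).ne.symm
  have hsbu : ∀ b, c ≤ b → b ≤ m → s b ∉ F.upper i := fun b hcb hb h =>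
    (hsbi b hcb hb).not_gt (mem_upper.1 h).2
  have hhigh : ∀ a b, a < c → c ≤ b → b ≤ m → p m < p a →
      F.SAnc (t a) (s b) ∧ (t a < s b ↔ p a < p b) := fun a b hac hcb hb ha => by
    refine ⟨(hti a (by omega)).trans (hisc b hcb hb), iff_of_false
      ((hsbi b hcb hb).trans (htgt a (by omega) ha)).not_gt ?_⟩
    rcases hcb.eq_or_lt with rfl | hcb
    · omega
    · exact hs.not_lt_of_last_lt hF hac hcb hb (by omega)
  have hB : (∀ a b, a < c → c ≤ b → b ≤ m → p a < p m → t a < s b) →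
      ∃ u, F.IsInstance p m x u ∧ ∀ l < m, u l ∉ F.upper i := fun hlow => by
    refine ⟨fun l => if l < c then t l else s l, ⟨by simp [hcm.not_gt, hs.1],
      fun a b hab hb => ?_⟩, fun l hl => ?_⟩
    · rcases lt_or_ge b c with hbc | hbc
      · simp only [hbc, hab.trans hbc, if_true]
        exact ht.2 a b hab hb
      rcases lt_or_ge a c with hac | hac
      · simp only [hac, hbc.not_gt, if_true, if_false]
        rcases lt_or_gt_of_ne (hp a (by omega)) with ha | ha
        · exact ⟨(hti a (by omega)).trans (hisc b hbc hb), iff_of_true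
            (hlow a b hac hbc hb ha) ((hs.2 a b hab hb).2.1 (hs.lt_of_lt_last hF hab hb ha))⟩
        · exact hhigh a b hac hbc hb ha
      · simp only [hac.not_gt, hbc.not_gt, if_false]
        exact hs.2 a b hab hb
    · rcases lt_or_ge l c with hlc | hlc
      · simpa [hlc] using htu l hl
      · simpa [hlc.not_gt] using hsbu l hlc hl.le
  rcases hcut with hcut | ⟨r, hrj, hpr, hcut⟩
  · exact hB fun a b hac _ _ ha => absurd (hcut a hac) (by omega)
  have hsrx : s r < x := (hslt r (by omega)).2 hpr
  have hsri : s r < i := hsrx.trans hxi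
  have hri : F.SAnc (s r) i := by
    rcases (hs.2 r j hrj hj.le).1.trichotomy hij with h | h | h
    · exact absurd h hsri.ne
    · exact h
    · exact absurd hij' (hF i (s r) (s j) h (hs.2 r j hrj hj.le).1 hsri)
  have hr1 : p m < p (r + 1) := hcut (r + 1) (by omega) (by omega)
  have hri1 : i < t (r + 1) := htgt (r + 1) (by omega) hr1
  rcases (hti (r + 1) (by omega)).trichotomy hri with h | h | h
  · exact absurd h (hsri.trans hri1).ne'
  · refine hB fun a b hac hcb hb ha => ?_
    have har : a ≤ r := by
      by_contra h'
      exact absurd (hcut a (by omega) hac) (by omega)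
    have h1 : F.SAnc (t a) (s r) := (ht.2 a (r + 1) (by omega) (by omega)).1.trans h
    have h2 : t a < s r := lt_of_le_of_ne (not_lt.1 fun h3 =>
      hF (t a) (s r) i h1 hri h3 ((htlt a (by omega)).2 ha)) h1.ne
    exact h2.trans (hs.lt_of_lt_last hF (by omega) hb hpr)
  · refine ⟨fun l => if r < l ∧ l < c then t l else s l, ⟨by simp [hcm.not_gt, hs.1],
      fun a b hab hb => ?_⟩, fun l hl => ?_⟩
    · by_cases hbm : r < b ∧ b < c
      · by_cases ham : r < a ∧ a < c
        · simp only [hbm, ham, and_self, if_true]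
          exact ht.2 a b hab hb
        · have har : a ≤ r := by omega
          simp only [hbm, ham, and_self, if_true, if_false]
          have hrb : F.SAnc (s r) (t b) := by
            rcases (Nat.succ_le_of_lt hbm.1).eq_or_lt with h' | h'
            · exact h' ▸ h
            · exact h.trans (ht.2 (r + 1) b h' hb).1
          have hib : i < t b := htgt b (by omega) (hcut b hbm.1 hbm.2)
          have hpb := hcut b hbm.1 hbm.2
          rcases har.eq_or_lt with rfl | har
          · exact ⟨hrb, iff_of_true (hsri.trans hib) (by omega)⟩
          have harS := (hs.2 a r har (by omega)).1
          refine ⟨harS.trans hrb, ?_⟩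
          rcases lt_or_gt_of_ne (hp a (by omega)) with ha | ha
          · exact iff_of_true ((((hslt a (by omega)).2 ha).trans hxi).trans hib) (by omega)
          · refine iff_of_false (hF _ _ _ harS hrb (hsrx.trans ?_))
              (hs.not_lt_of_last_lt hF har hbm.1 hb (by omega))
            exact lt_of_le_of_ne (not_lt.1 ((hslt a (by omega)).not.2 (by omega)))
              (hsx a (by omega)).ne.symm
      · by_cases ham : r < a ∧ a < c
        · simp only [hbm, ham, and_self, if_true, if_false]
          exact hhigh a b ham.2 (by omega) hb (hcut a ham.1 ham.2)
        · simp only [hbm, ham, if_false]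
          exact hs.2 a b hab hb
    · by_cases hlm : r < l ∧ l < c
      · simpa [hlm] using htu l hl
      · simp only [hlm, if_false]
        rcases lt_or_ge l c with hlc | hlc
        · have hlr : l ≤ r := by omega
          intro h'
          rcases hlr.eq_or_lt with rfl | hlr
          · exact hsri.not_gt (mem_upper.1 h').2
          · exact ((mem_upper.1 h').1.trans (hs.2 l r hlr (by omega)).1).asymm hri
        · exact hsbu l hlc hl.le

end Instances

/-- The permutation of `Fin n` reversing the order of `S` and fixing its complement. -/
noncomputable def revOn (S : Finset (Fin n)) : Equiv.Perm (Fin n) :=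
  Equiv.Perm.ofSubtype
    ((((S.orderIsoOfFin rfl).toEquiv.symm.trans Fin.revPerm).trans
      (S.orderIsoOfFin rfl).toEquiv : Equiv.Perm S))

theorem revOn_of_notMem {S : Finset (Fin n)} {a : Fin n} (h : a ∉ S) : revOn S a = a :=
  Equiv.Perm.ofSubtype_apply_of_not_mem _ h

theorem revOn_mem {S : Finset (Fin n)} {a : Fin n} (h : a ∈ S) : revOn S a ∈ S := by
  unfold revOn
  rw [Equiv.Perm.ofSubtype_apply_of_mem _ h]
  exact Subtype.prop _

theorem revOn_mem_iff {S : Finset (Fin n)} {a : Fin n} : revOn S a ∈ S ↔ a ∈ S := by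
  refine ⟨fun h => ?_, revOn_mem⟩
  by_contra h'
  exact h' (revOn_of_notMem h' ▸ h)

theorem revOn_revOn {S : Finset (Fin n)} (a : Fin n) : revOn S (revOn S a) = a := by
  have h : revOn S * revOn S = 1 := by
    unfold revOn
    rw [← map_mul, ← map_one (Equiv.Perm.ofSubtype (p := (· ∈ S)))]
    congr 1
    ext b
    simp
  exact Equiv.congr_fun h a

theorem revOn_symm (S : Finset (Fin n)) : (revOn S).symm = revOn S := by
  ext1 a
  rw [Equiv.symm_apply_eq, revOn_revOn]

theorem revOn_lt_revOn {S : Finset (Fin n)} {a b : Fin n} (ha : a ∈ S) (hb : b ∈ S) :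
    revOn S a < revOn S b ↔ b < a := by
  unfold revOn
  rw [Equiv.Perm.ofSubtype_apply_of_mem _ ha, Equiv.Perm.ofSubtype_apply_of_mem _ hb,
    Subtype.coe_lt_coe]
  simp

/-- Reverse the labels above `i` among the descendants of `i`. -/
noncomputable def flip (F : RForest n) (i : Fin n) : RForest n :=
  F.transport (revOn (F.upper i))

/-- The descendants of `x` with label greater than `x` increase along chains. -/
def Inc (F : RForest n) (x : Fin n) : Prop :=
  ∀ y ∈ F.upper x, ∀ z ∈ F.upper x, F.SAnc y z → y < z

/-- The descendants of `x` with label greater than `x` decrease along chains. -/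
def Dec (F : RForest n) (x : Fin n) : Prop :=
  ∀ y ∈ F.upper x, ∀ z ∈ F.upper x, F.SAnc y z → z < y

/-- `x` is marked and has no smaller marked strict ancestor. -/
def Primary (F : RForest n) (p : ℕ → ℕ) (m : ℕ) (x : Fin n) : Prop :=
  F.Marked p m x ∧ ∀ w, F.Marked p m w → F.SAnc w x → ¬ w < x

section Flip

variable {F : RForest n} {p : ℕ → ℕ} {m : ℕ} {i : Fin n}

theorem self_notMem_upper : i ∉ F.upper i := fun h => (mem_upper.1 h).2.false

theorem sAnc_flip {a b : Fin n} :
    (F.flip i).SAnc (revOn (F.upper i) a) (revOn (F.upper i) b) ↔ F.SAnc a b :=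
  sAnc_transport

theorem revOn_lt_iff (hF : F.Avoids213) {a b : Fin n} (hab : F.SAnc a b)
    (h : a ∉ F.upper i ∨ b ∉ F.upper i) :
    revOn (F.upper i) a < revOn (F.upper i) b ↔ a < b := by
  by_cases hb : b ∈ F.upper i
  · have ha : a ∉ F.upper i := h.resolve_right (not_not.2 hb)
    have hb' := revOn_mem hb
    rw [revOn_of_notMem ha]
    rcases hab.trichotomy (mem_upper.1 hb).1 with rfl | h' | h'
    · exact iff_of_true (mem_upper.1 hb').2 (mem_upper.1 hb).2
    · rw [lt_iff_of_mem_upper hF h' hb, lt_iff_of_mem_upper hF h' hb']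
    · exact absurd (mem_upper.1 hb).2 (hF _ _ _ h' hab (lt_of_notMem_upper h' ha))
  · rw [revOn_of_notMem hb]
    by_cases ha : a ∈ F.upper i
    · have ha' := mem_upper.1 (revOn_mem ha)
      have hbi := lt_of_notMem_upper ((mem_upper.1 ha).1.trans hab) hb
      exact iff_of_false (hbi.trans ha'.2).not_gt (hbi.trans (mem_upper.1 ha).2).not_gt
    · rw [revOn_of_notMem ha]

theorem upper_flip_self (hF : F.Avoids213) : (F.flip i).upper i = F.upper i := by
  ext y
  obtain ⟨y, rfl⟩ := (revOn (F.upper i)).surjective y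
  rw [revOn_mem_iff, mem_upper, mem_upper]
  have h := sAnc_flip (F := F) (i := i) (a := i) (b := y)
  rw [revOn_of_notMem self_notMem_upper] at h
  rw [h]
  refine and_congr_right fun hy => ?_
  have := revOn_lt_iff hF hy (Or.inl self_notMem_upper)
  rwa [revOn_of_notMem self_notMem_upper] at this

theorem flip_flip (hF : F.Avoids213) : (F.flip i).flip i = F := by
  rw [flip, upper_flip_self hF, flip]
  cases F
  simp [transport, revOn_symm, revOn_revOn, Function.comp_def]

theorem Avoids213.flip (hF : F.Avoids213) (hi : F.Inc i ∨ F.Dec i) : (F.flip i).Avoids213 := by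
  intro a b c
  obtain ⟨a, rfl⟩ := (revOn (F.upper i)).surjective a
  obtain ⟨b, rfl⟩ := (revOn (F.upper i)).surjective b
  obtain ⟨c, rfl⟩ := (revOn (F.upper i)).surjective c
  rw [sAnc_flip, sAnc_flip]
  intro hab hbc hba hac
  have hne : ∀ {x y : Fin n}, F.SAnc x y → ¬ x < y → y < x := fun h h' =>
    lt_of_le_of_ne (not_lt.1 h') h.ne.symm
  by_cases ha : a ∈ F.upper i
  swap
  · have h1 := revOn_lt_iff hF hab (Or.inl ha)
    have h2 := revOn_lt_iff hF (hab.trans hbc) (Or.inl ha)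
    exact hF a b c hab hbc (hne hab (h1.not.1 hba.not_gt)) (h2.1 hac)
  have hia := (mem_upper.1 ha).1
  by_cases hc : c ∈ F.upper i
  · have hb : b ∈ F.upper i := by
      by_contra hb
      exact hF i b c (hia.trans hab) hbc (lt_of_notMem_upper (hia.trans hab) hb) (mem_upper.1 hc).2
    rw [revOn_lt_revOn hb ha] at hba
    rw [revOn_lt_revOn ha hc] at hac
    rcases hi with hi | hi
    · exact (hi a ha c hc (hab.trans hbc)).not_gt hac
    · exact (hi a ha b hb hab).not_gt hba
  · have h2 := (revOn_lt_iff hF (hab.trans hbc) (Or.inr hc)).1 hac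
    exact (lt_of_notMem_upper (hia.trans (hab.trans hbc)) hc).not_gt ((mem_upper.1 ha).2.trans h2)

theorem inc_flip_self (hF : F.Avoids213) (h : F.Dec i) : (F.flip i).Inc i := by
  intro y hy z hz
  rw [upper_flip_self hF] at hy hz
  obtain ⟨y, rfl⟩ := (revOn (F.upper i)).surjective y
  obtain ⟨z, rfl⟩ := (revOn (F.upper i)).surjective z
  rw [revOn_mem_iff] at hy hz
  rw [sAnc_flip, revOn_lt_revOn hy hz]
  exact h y hy z hz

theorem dec_flip_self (hF : F.Avoids213) (h : F.Inc i) : (F.flip i).Dec i := by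
  intro y hy z hz
  rw [upper_flip_self hF] at hy hz
  obtain ⟨y, rfl⟩ := (revOn (F.upper i)).surjective y
  obtain ⟨z, rfl⟩ := (revOn (F.upper i)).surjective z
  rw [revOn_mem_iff] at hy hz
  rw [sAnc_flip, revOn_lt_revOn hz hy]
  exact h y hy z hz

theorem Marked.of_mem_upper (hF : F.Avoids213) (hi : F.Marked p m i) {x : Fin n}
    (hx : x ∈ F.upper i) : F.Marked p m x :=
  hi.elim fun _ ht => ⟨_, ht.of_mem_upper hF hx⟩

theorem Marked.flip_apply (hF : F.Avoids213) (hp : ∀ l < m, p l ≠ p m) (hi : F.Marked p m i)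
    {x : Fin n} (hx : F.Marked p m x) : (F.flip i).Marked p m (revOn (F.upper i) x) := by
  obtain ⟨t, ht⟩ := hi
  obtain ⟨s, hs⟩ := hx
  obtain ⟨u, hu, hu'⟩ := hs.exists_notMem_upper hF hp ht
  refine ⟨fun l => revOn (F.upper i) (u l), congrArg _ hu.1, fun a b hab hb => ?_⟩
  obtain ⟨h1, h2⟩ := hu.2 a b hab hb
  exact ⟨sAnc_flip.2 h1, (revOn_lt_iff hF h1 (Or.inl (hu' a (by omega)))).trans h2⟩

theorem marked_flip_self (hF : F.Avoids213) (hp : ∀ l < m, p l ≠ p m) (hi : F.Marked p m i) :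
    (F.flip i).Marked p m i := by
  simpa [revOn_of_notMem (self_notMem_upper (F := F) (i := i))] using hi.flip_apply hF hp hi

theorem Marked.flip (hF : F.Avoids213) (hF' : (F.flip i).Avoids213) (hp : ∀ l < m, p l ≠ p m)
    (hi : F.Marked p m i) {x : Fin n} (hx : F.Marked p m x) : (F.flip i).Marked p m x := by
  by_cases h : x ∈ F.upper i
  · exact (marked_flip_self hF hp hi).of_mem_upper hF' (by rwa [upper_flip_self hF])
  · simpa [revOn_of_notMem h] using hi.flip_apply hF hp hx

theorem Primary.flip (hF : F.Avoids213) (hF' : (F.flip i).Avoids213) (hp : ∀ l < m, p l ≠ p m)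
    (hi : F.Marked p m i) {x : Fin n} (hx : F.Primary p m x) : (F.flip i).Primary p m x := by
  refine ⟨hi.flip hF hF' hp hx.1, fun w hw hwx hlt => ?_⟩
  have hxi : x ∉ F.upper i := fun h => hx.2 i hi (mem_upper.1 h).1 (mem_upper.1 h).2
  replace hw := (marked_flip_self hF hp hi).flip hF' (by rwa [flip_flip hF]) hp hw
  rw [flip_flip hF] at hw
  obtain ⟨v, rfl⟩ := (revOn (F.upper i)).surjective w
  rw [← revOn_of_notMem hxi] at hwx
  rw [sAnc_flip] at hwx
  by_cases hv : v ∈ F.upper i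
  · exact (lt_of_notMem_upper ((mem_upper.1 hv).1.trans hwx) hxi).not_gt
      ((mem_upper.1 (revOn_mem hv)).2.trans hlt)
  · rw [revOn_of_notMem hv] at hw hlt
    exact hx.2 v hw hwx hlt

theorem upper_disjoint (hF : F.Avoids213) {x : Fin n} (hx : F.Primary p m x)
    (hi : F.Primary p m i) (hne : x ≠ i) {y : Fin n} (hy : y ∈ F.upper x) : y ∉ F.upper i := by
  have key : ∀ {u v : Fin n}, F.Primary p m u → F.Primary p m v → F.SAnc u v →
      y ∈ F.upper u → y ∈ F.upper v → False := fun {u v} hu hv huv hyu hyv =>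
    hF u v y huv (mem_upper.1 hyv).1
      (lt_of_le_of_ne (not_lt.1 (hv.2 u hu.1 huv)) huv.ne.symm) (mem_upper.1 hyu).2
  intro hy'
  rcases (mem_upper.1 hy).1.trichotomy (mem_upper.1 hy').1 with h | h | h
  · exact hne h
  · exact key hx hi h hy hy'
  · exact key hi hx h hy' hy

theorem Primary.exists_of_flip (hF : F.Avoids213) {x : Fin n} (hx : F.Primary p m x)
    (hi : F.Primary p m i) (hne : x ≠ i) {y z : Fin n} (hy : y ∈ (F.flip i).upper x)
    (hz : z ∈ (F.flip i).upper x) (hyz : (F.flip i).SAnc y z) :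
    ∃ y' ∈ F.upper x, ∃ z' ∈ F.upper x, F.SAnc y' z' ∧ (y < z ↔ y' < z') := by
  have hxi : x ∉ F.upper i := fun h => hx.2 i hi.1 (mem_upper.1 h).1 (mem_upper.1 h).2
  have key : ∀ {y}, revOn (F.upper i) y ∈ (F.flip i).upper x → y ∈ F.upper x := fun {y} hy => by
    rw [mem_upper] at hy ⊢
    obtain ⟨h1, h2⟩ := hy
    rw [← revOn_of_notMem hxi] at h2
    nth_rw 1 [← revOn_of_notMem hxi] at h1
    rw [sAnc_flip] at h1
    exact ⟨h1, (revOn_lt_iff hF h1 (Or.inl hxi)).1 h2⟩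
  obtain ⟨y, rfl⟩ := (revOn (F.upper i)).surjective y
  obtain ⟨z, rfl⟩ := (revOn (F.upper i)).surjective z
  rw [sAnc_flip] at hyz
  exact ⟨y, key hy, z, key hz, hyz,
    revOn_lt_iff hF hyz (Or.inl (upper_disjoint hF hx hi hne (key hy)))⟩

theorem inc_flip (hF : F.Avoids213) {x : Fin n} (hx : F.Primary p m x)
    (hi : F.Primary p m i) (hne : x ≠ i) (h : F.Inc x) : (F.flip i).Inc x := by
  intro y hy z hz hyz
  obtain ⟨y', hy', z', hz', h1, h2⟩ := hx.exists_of_flip hF hi hne hy hz hyz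
  exact h2.2 (h y' hy' z' hz' h1)

theorem dec_flip (hF : F.Avoids213) {x : Fin n} (hx : F.Primary p m x)
    (hi : F.Primary p m i) (hne : x ≠ i) (h : F.Dec x) : (F.flip i).Dec x := by
  intro y hy z hz hyz
  obtain ⟨y', hy', z', hz', h1, h2⟩ := hx.exists_of_flip hF hi hne hy hz hyz
  exact lt_of_le_of_ne (not_lt.1 (h2.not.2 (h y' hy' z' hz' h1).not_gt)) hyz.ne.symm

end Flip

/-- `F` avoids `213`, and below its primary vertices `x` it is increasing if `x ∈ P` and
decreasing otherwise. -/
def IsMixed (F : RForest n) (p : ℕ → ℕ) (m : ℕ) (P : Finset (Fin n)) : Prop :=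
  F.Avoids213 ∧ ∀ x, F.Primary p m x → (x ∈ P → F.Inc x) ∧ (x ∉ P → F.Dec x)

open Classical in
/-- Flip below `i` if `i` is primary. -/
noncomputable def flipPrimary (p : ℕ → ℕ) (m : ℕ) (i : Fin n) (F : RForest n) : RForest n :=
  if F.Primary p m i then F.flip i else F

theorem IsMixed.flipPrimary {F : RForest n} {p : ℕ → ℕ} {m : ℕ} (hp : ∀ l < m, p l ≠ p m)
    {P Q : Finset (Fin n)} {i : Fin n} (hPQ : ∀ x, x ≠ i → (x ∈ P ↔ x ∈ Q))
    (hi : i ∈ P ↔ i ∉ Q) (h : F.IsMixed p m P) :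
    (F.flipPrimary p m i).IsMixed p m Q ∧ (F.flipPrimary p m i).flipPrimary p m i = F := by
  unfold RForest.flipPrimary
  obtain ⟨hF, hF2⟩ := h
  by_cases hpi : F.Primary p m i
  swap
  · rw [if_neg hpi, if_neg hpi]
    refine ⟨⟨hF, fun x hx => ?_⟩, rfl⟩
    rw [← hPQ x (fun h => hpi (h ▸ hx))]
    exact hF2 x hx
  have hF' : (F.flip i).Avoids213 := by
    refine hF.flip ?_
    by_cases hiP : i ∈ P
    · exact Or.inl ((hF2 i hpi).1 hiP)
    · exact Or.inr ((hF2 i hpi).2 hiP)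
  have hff : ((F.flip i).flip i).Avoids213 := by rwa [flip_flip hF]
  rw [if_pos hpi, if_pos (hpi.flip hF hF' hp hpi.1), flip_flip hF]
  refine ⟨⟨hF', fun x hx => ?_⟩, rfl⟩
  replace hx := hx.flip hF' hff hp (marked_flip_self hF hp hpi.1)
  rw [flip_flip hF] at hx
  by_cases hxi : x = i
  · subst hxi
    exact ⟨fun h => inc_flip_self hF ((hF2 x hx).2 (by tauto)),
      fun h => dec_flip_self hF ((hF2 x hx).1 (by tauto))⟩
  · rw [← hPQ x hxi]
    exact ⟨fun h => inc_flip hF hx hpi hxi ((hF2 x hx).1 h),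
      fun h => dec_flip hF hx hpi hxi ((hF2 x hx).2 h)⟩

theorem card_isMixed_insert {p : ℕ → ℕ} {m : ℕ} (hp : ∀ l < m, p l ≠ p m)
    {P : Finset (Fin n)} {i : Fin n} (hi : i ∉ P) :
    Nat.card {F : RForest n // F.IsMixed p m (insert i P)} =
      Nat.card {F : RForest n // F.IsMixed p m P} := by
  have h1 : ∀ {F : RForest n}, F.IsMixed p m (insert i P) → _ := fun h =>
    h.flipPrimary hp (i := i) (Q := P) (fun x hx => by simp [hx]) (by simp [hi])
  have h2 : ∀ {F : RForest n}, F.IsMixed p m P → _ := fun h =>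
    h.flipPrimary hp (i := i) (Q := insert i P) (fun x hx => by simp [hx]) (by simp [hi])
  exact Nat.card_congr
    { toFun := fun F => ⟨_, (h1 F.2).1⟩
      invFun := fun F => ⟨_, (h2 F.2).1⟩
      left_inv := fun F => Subtype.ext (h1 F.2).2
      right_inv := fun F => Subtype.ext (h2 F.2).2 }

theorem card_isMixed {p : ℕ → ℕ} {m : ℕ} (hp : ∀ l < m, p l ≠ p m) (P : Finset (Fin n)) :
    Nat.card {F : RForest n // F.IsMixed p m P} =
      Nat.card {F : RForest n // F.IsMixed p m ∅} := by
  induction P using Finset.induction_on with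
  | empty => rfl
  | insert i P hi ih => rw [card_isMixed_insert hp hi, ih]

/-- Every marked vertex lies weakly above, in label and in depth, some primary one. -/
theorem Marked.exists_primary {F : RForest n} {p : ℕ → ℕ} {m : ℕ} {x : Fin n}
    (hx : F.Marked p m x) : ∃ w, F.Primary p m w ∧ (w = x ∨ x ∈ F.upper w) := by
  induction x using WellFoundedLT.induction with
  | ind x ih =>
    by_cases h : F.Primary p m x
    · exact ⟨x, h, Or.inl rfl⟩
    · simp only [Primary, hx, true_and, not_forall, not_not] at h
      obtain ⟨w, hw, hwx, hlt⟩ := h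
      obtain ⟨u, hu, h⟩ := ih w hlt hw
      refine ⟨u, hu, Or.inr ?_⟩
      rcases h with rfl | h
      · exact mem_upper.2 ⟨hwx, hlt⟩
      · rw [mem_upper] at h ⊢
        exact ⟨h.1.trans hwx, h.2.trans hlt⟩

theorem Marked.exists_primary_upper_subset {F : RForest n} {p : ℕ → ℕ} {m : ℕ} {x : Fin n}
    (hx : F.Marked p m x) : ∃ w, F.Primary p m w ∧ F.upper x ⊆ F.upper w := by
  obtain ⟨w, hw, rfl | h⟩ := hx.exists_primary
  · exact ⟨w, hw, subset_rfl⟩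
  · refine ⟨w, hw, fun y hy => ?_⟩
    rw [mem_upper] at h hy ⊢
    exact ⟨h.1.trans hy.1, h.2.trans hy.2⟩

/-- Containment of a pattern whose last two values lie just above the third to last one. -/
theorem containsPat_iff {F : RForest n} (hF : F.Avoids213) {m : ℕ} (ρ : Pattern (m + 3))
    (p : ℕ → ℕ) (hp : ∀ l : Fin (m + 3), (l : ℕ) ≤ m → p l = ρ l)
    (hlt : ∀ l r : Fin (m + 3), (l : ℕ) ≤ m → m < r → (ρ l < ρ r ↔ p l ≤ p m)) :
    ContainsPat F ρ ↔ ∃ x, F.Marked p m x ∧ ∃ y ∈ F.upper x, ∃ z ∈ F.upper x, F.SAnc y z ∧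
      (y < z ↔ ρ ⟨m + 1, by omega⟩ < ρ ⟨m + 2, by omega⟩) := by
  constructor
  · rintro ⟨v, hv, hv'⟩
    have hup : ∀ r : Fin (m + 3), m < r → v r ∈ F.upper (v ⟨m, by omega⟩) := fun r hr =>
      mem_upper.2 ⟨hv _ _ hr, (hv' _ _).2 ((hlt ⟨m, by omega⟩ r le_rfl hr).2 le_rfl)⟩
    refine ⟨v ⟨m, by omega⟩, ⟨fun l => if h : l < m + 3 then v ⟨l, h⟩ else v 0,
      by simp, fun a b hab hb => ?_⟩, v ⟨m + 1, by omega⟩, hup _ (by simp),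
      v ⟨m + 2, by omega⟩, hup _ (by simp), hv _ _ (by simp [Fin.lt_def]), hv' _ _⟩
    have ha3 : a < m + 3 := by omega
    have hb3 : b < m + 3 := by omega
    have ha' := hp ⟨a, ha3⟩ (by simp; omega)
    have hb' := hp ⟨b, hb3⟩ hb
    simp only at ha' hb'
    simp only [ha3, hb3, dif_pos]
    rw [ha', hb', hv', Fin.val_fin_lt]
    exact ⟨hv _ _ hab, Iff.rfl⟩
  · rintro ⟨x, ⟨s, hs⟩, y, hy, z, hz, hyz, hiff⟩
    have hpne : ∀ l < m, p l ≠ p m := fun l hl h => by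
      have h1 := hp ⟨l, by omega⟩ hl.le
      have h2 := hp ⟨m, by omega⟩ le_rfl
      simp only at h1 h2
      rw [h1, h2, Fin.val_inj, ρ.injective.eq_iff, Fin.mk.injEq] at h
      omega
    have hsw : ∀ w ∈ F.upper x, ∀ l ≤ m, F.SAnc (s l) w ∧ (s l < w ↔ p l ≤ p m) := by
      intro w hw l hl
      rcases hl.eq_or_lt with rfl | hl
      · rw [hs.1]
        exact ⟨(mem_upper.1 hw).1, iff_of_true (mem_upper.1 hw).2 le_rfl⟩
      · have h := hs.2 l m hl le_rfl
        rw [hs.1] at h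
        refine ⟨h.1.trans (mem_upper.1 hw).1, ?_⟩
        rw [lt_iff_of_mem_upper hF h.1 hw, h.2]
        have := hpne l hl
        omega
    let v : Fin (m + 3) → Fin n := fun l =>
      if (l : ℕ) ≤ m then s l else if (l : ℕ) = m + 1 then y else z
    have hv1 : ∀ l : Fin (m + 3), (l : ℕ) ≤ m → v l = s l := fun l h => by simp [v, h]
    have hv2 : ∀ l : Fin (m + 3), m < (l : ℕ) → v l ∈ F.upper x := fun l h => by
      simp only [v, h.not_ge, if_false]
      split_ifs <;> assumption
    have key : ∀ a b : Fin (m + 3), a < b → F.SAnc (v a) (v b) ∧ (v a < v b ↔ ρ a < ρ b) := by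
      intro a b hab
      have hab' : (a : ℕ) < b := hab
      rcases le_or_gt (b : ℕ) m with hb | hb
      · have h := hs.2 a b hab hb
        rw [hv1 a (by omega), hv1 b hb, ← Fin.val_fin_lt (a := ρ a), ← hp a (by omega), ← hp b hb]
        exact h
      rcases le_or_gt (a : ℕ) m with ha | ha
      · rw [hv1 a ha, hlt a b ha hb]
        exact hsw _ (hv2 b hb) a ha
      · have ha1 : a = ⟨m + 1, by omega⟩ := Fin.ext (by simp; omega)
        have hb1 : b = ⟨m + 2, by omega⟩ := Fin.ext (by simp; omega)
        rw [ha1, hb1]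
        simpa [v] using ⟨hyz, hiff⟩
    refine ⟨v, fun a b hab => (key a b hab).1, fun a b => ?_⟩
    rcases lt_trichotomy a b with h | rfl | h
    · exact (key a b h).2
    · simp
    · have h1 := key b a h
      have h2 := ρ.injective.ne h.ne
      have h3 := h1.1.ne
      rw [← not_iff_not, not_lt, not_lt, h3.le_iff_lt, h2.le_iff_lt]
      exact h1.2

theorem isMixed_empty_iff {F : RForest n} {p : ℕ → ℕ} {m : ℕ} (hF : F.Avoids213) :
    F.IsMixed p m ∅ ↔ ¬ ∃ x, F.Marked p m x ∧ ∃ y ∈ F.upper x, ∃ z ∈ F.upper x,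
      F.SAnc y z ∧ y < z := by
  constructor
  · rintro ⟨-, h⟩ ⟨x, hx, y, hy, z, hz, hyz, hlt⟩
    obtain ⟨w, hw, hsub⟩ := hx.exists_primary_upper_subset
    exact ((h w hw).2 (Finset.notMem_empty w) y (hsub hy) z (hsub hz) hyz).not_gt hlt
  · intro h
    refine ⟨hF, fun x hx => ⟨by simp, fun _ y hy z hz hyz => ?_⟩⟩
    by_contra h'
    exact h ⟨x, hx.1, y, hy, z, hz, hyz, lt_of_le_of_ne (not_lt.1 h') hyz.ne⟩

theorem isMixed_univ_iff {F : RForest n} {p : ℕ → ℕ} {m : ℕ} (hF : F.Avoids213) :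
    F.IsMixed p m Finset.univ ↔ ¬ ∃ x, F.Marked p m x ∧ ∃ y ∈ F.upper x, ∃ z ∈ F.upper x,
      F.SAnc y z ∧ ¬ y < z := by
  constructor
  · rintro ⟨-, h⟩ ⟨x, hx, y, hy, z, hz, hyz, hlt⟩
    obtain ⟨w, hw, hsub⟩ := hx.exists_primary_upper_subset
    exact hlt ((h w hw).1 (Finset.mem_univ w) y (hsub hy) z (hsub hz) hyz)
  · intro h
    refine ⟨hF, fun x hx => ⟨fun _ y hy z hz hyz => ?_, by simp⟩⟩
    by_contra h'
    exact h ⟨x, hx.1, y, hy, z, hz, hyz, h'⟩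

end RForest

/-- If `π(k) = π(k-1) + 1 = π(k-2) + 2`, then `{213, π}` and `{213, π̃}` are
forest-Wilf equivalent, where `π̃` is the twist of `π` (last two entries swapped). -/
theorem forestWilf_213_twist (k : ℕ) (hk : 3 ≤ k) (π : Pattern k)
    (h1 : (π ⟨k - 1, by omega⟩ : ℕ) = (π ⟨k - 2, by omega⟩ : ℕ) + 1)
    (h2 : (π ⟨k - 1, by omega⟩ : ℕ) = (π ⟨k - 3, by omega⟩ : ℕ) + 2) :
    ∀ n : ℕ,
      Nat.card {F : RForest n // ¬ ContainsPat F p213 ∧ ¬ ContainsPat F π} =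
      Nat.card {F : RForest n // ¬ ContainsPat F p213 ∧
        ¬ ContainsPat F ((Equiv.swap (⟨k - 2, by omega⟩ : Fin k) ⟨k - 1, by omega⟩).trans π)} := by
  intro n
  obtain ⟨m, rfl⟩ := Nat.exists_eq_add_of_le' hk
  have e1 : (⟨m + 3 - 1, by omega⟩ : Fin (m + 3)) = ⟨m + 2, by omega⟩ := Fin.ext (by simp)
  have e2 : (⟨m + 3 - 2, by omega⟩ : Fin (m + 3)) = ⟨m + 1, by omega⟩ := Fin.ext (by simp)
  have e3 : (⟨m + 3 - 3, by omega⟩ : Fin (m + 3)) = ⟨m, by omega⟩ := Fin.ext (by simp)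
  rw [e1, e2] at h1
  rw [e1, e3] at h2
  rw [e1, e2]
  set A : Fin (m + 3) := ⟨m, by omega⟩
  set B : Fin (m + 3) := ⟨m + 1, by omega⟩
  set C : Fin (m + 3) := ⟨m + 2, by omega⟩
  let p : ℕ → ℕ := fun l => if h : l < m + 3 then π ⟨l, h⟩ else 0
  have hpπ : ∀ l : Fin (m + 3), p l = π l := fun l => by simp [p]
  have hpm : p m = π A := hpπ A
  have hBC : ∀ r : Fin (m + 3), m < r → r = B ∨ r = C := fun r hr => by
    simp only [B, C, Fin.ext_iff]
    omega
  have hne : ∀ l r : Fin (m + 3), l ≠ r → (π l : ℕ) ≠ π r := fun l r h h' =>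
    h (π.injective (Fin.ext h'))
  have hlow : ∀ l : Fin (m + 3), (l : ℕ) ≤ m → l ≠ B ∧ l ≠ C := fun l hl => by
    simp only [B, C, ne_eq, Fin.ext_iff]
    omega
  have hπ : ∀ l r : Fin (m + 3), (l : ℕ) ≤ m → r = B ∨ r = C → (π l < π r ↔ p l ≤ p m) := by
    intro l r hl hr
    rw [Fin.lt_def, hpπ, hpm]
    have hB := hne l B (hlow l hl).1
    have hC := hne l C (hlow l hl).2
    rcases hr with rfl | rfl <;> omega
  have hswap : ∀ l : Fin (m + 3), (l : ℕ) ≤ m → (Equiv.swap B C).trans π l = π l := fun l hl => by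
    rw [Equiv.trans_apply, Equiv.swap_apply_of_ne_of_ne (hlow l hl).1 (hlow l hl).2]
  have hp : ∀ l < m, p l ≠ p m := fun l hl => by
    have := hne ⟨l, by omega⟩ A (by simp [A, Fin.ext_iff]; omega)
    rw [hpm]
    rwa [← hpπ] at this
  have hdec : ∀ F : RForest n, (¬ ContainsPat F p213 ∧ ¬ ContainsPat F π) ↔ F.IsMixed p m ∅ := by
    intro F
    rw [RForest.not_containsPat_p213]
    refine Iff.trans (and_congr_right fun hF => ?_) (and_iff_right_of_imp fun h => h.1)
    rw [RForest.isMixed_empty_iff hF, RForest.containsPat_iff hF π p (fun l _ => hpπ l)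
      (fun l r hl hr => hπ l r hl (hBC r hr))]
    have : π B < π C := by rw [Fin.lt_def]; omega
    simp only [B, C] at this
    simp only [this, iff_true]
  have hinc : ∀ F : RForest n, (¬ ContainsPat F p213 ∧
      ¬ ContainsPat F ((Equiv.swap B C).trans π)) ↔ F.IsMixed p m Finset.univ := by
    intro F
    rw [RForest.not_containsPat_p213]
    refine Iff.trans (and_congr_right fun hF => ?_) (and_iff_right_of_imp fun h => h.1)
    rw [RForest.isMixed_univ_iff hF, RForest.containsPat_iff hF ((Equiv.swap B C).trans π) p
      (fun l hl => by rw [hswap l hl, hpπ]) (fun l r hl hr => ?_)]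
    · have : ¬ (Equiv.swap B C).trans π B < (Equiv.swap B C).trans π C := by
        simp only [Equiv.trans_apply, Equiv.swap_apply_left, Equiv.swap_apply_right, Fin.lt_def]
        omega
      simp only [B, C] at this
      simp only [B, C, this, iff_false]
    · rw [hswap l hl]
      rcases hBC r hr with rfl | rfl
      · rw [Equiv.trans_apply, Equiv.swap_apply_left]
        exact hπ l C hl (Or.inr rfl)
      · rw [Equiv.trans_apply, Equiv.swap_apply_right]
        exact hπ l B hl (Or.inl rfl)
  simp only [hdec, hinc]
  exact (RForest.card_isMixed hp _).symm
end

section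
/- For every integer n ≥ 4, there exist at least 2^{n−4} pairwise distinct patterns of length n that are pairwise c-forest-Wilf equivalent. -/
open Classical in
/-- Reverse the order of the elements of `A`, fixing everything outside `A`. -/
noncomputable def Finset.reverseOn {n : ℕ} (A : Finset (Fin n)) (y : Fin n) : Fin n :=
  if h : y ∈ A then
    (A.orderIsoOfFin rfl ((A.orderIsoOfFin rfl).symm ⟨y, h⟩).rev : Fin n)
  else y

namespace Finset

variable {n : ℕ} {A : Finset (Fin n)} {y z : Fin n}

lemma reverseOn_of_notMem (h : y ∉ A) : A.reverseOn y = y := dif_neg h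

lemma reverseOn_mem (h : y ∈ A) : A.reverseOn y ∈ A := by
  rw [reverseOn, dif_pos h]
  exact Subtype.coe_prop _

lemma reverseOn_reverseOn (A : Finset (Fin n)) (y : Fin n) :
    A.reverseOn (A.reverseOn y) = y := by
  by_cases h : y ∈ A
  · have h' := reverseOn_mem h
    have he : (⟨A.reverseOn y, h'⟩ : A) =
        A.orderIsoOfFin rfl ((A.orderIsoOfFin rfl).symm ⟨y, h⟩).rev := Subtype.ext (dif_pos h)
    rw [reverseOn, dif_pos h', he, OrderIso.symm_apply_apply, Fin.rev_rev,
      OrderIso.apply_symm_apply]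
  · rw [reverseOn_of_notMem h, reverseOn_of_notMem h]

lemma reverseOn_lt_reverseOn (hy : y ∈ A) (hz : z ∈ A) :
    A.reverseOn y < A.reverseOn z ↔ z < y := by
  rw [reverseOn, reverseOn, dif_pos hy, dif_pos hz, Subtype.coe_lt_coe, OrderIso.lt_iff_lt,
    Fin.rev_lt_rev, OrderIso.lt_iff_lt, ← Subtype.coe_lt_coe]

end Finset

/-- The positions of the parity of `i` from `i` on. -/
def Pattern.Alt {k : ℕ} (i : ℕ) (a : Fin k) : Prop := i ≤ a ∧ (a : ℕ) % 2 = i % 2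

/-- The pattern starts with its two smallest values; afterwards odd positions lie below the
value at position `2` and even positions lie above it. -/
structure Pattern.IsZigzag {k : ℕ} (π : Pattern k) : Prop where
  low : ∀ a b : Fin k, (a : ℕ) ≤ 1 → a < b → π a < π b
  odd : ∀ a b : Fin k, (a : ℕ) = 2 → 3 ≤ (b : ℕ) → (b : ℕ) % 2 = 1 → π b < π a
  even : ∀ a b : Fin k, (a : ℕ) = 2 → 3 ≤ (b : ℕ) → (b : ℕ) % 2 = 0 → π a < π b

/-- `π'` is obtained from the zigzag pattern `π` by reversing the relative order of the values
at the positions `Alt i`, which form an interval of values. -/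
structure Pattern.IsReversal {k : ℕ} (i : ℕ) (π π' : Pattern k) : Prop where
  left : π.IsZigzag
  right : π'.IsZigzag
  reversed : ∀ a b : Fin k, Pattern.Alt i a → Pattern.Alt i b → (π' a < π' b ↔ π b < π a)
  same : ∀ a b : Fin k, ¬ (Pattern.Alt i a ∧ Pattern.Alt i b) → (π' a < π' b ↔ π a < π b)
  convex : ∀ a b c : Fin k, ¬ Pattern.Alt i a → Pattern.Alt i b → Pattern.Alt i c →
    (π a < π b ↔ π a < π c)

lemma Pattern.IsReversal.symm {k i : ℕ} {π π' : Pattern k} (h : Pattern.IsReversal i π π') :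
    Pattern.IsReversal i π' π where
  left := h.right
  right := h.left
  reversed a b ha hb := (h.reversed b a hb ha).symm
  same a b hab := (h.same a b hab).symm
  convex a b c ha hb hc := by
    rw [h.same a b (fun h => ha h.1), h.same a c (fun h => ha h.1)]
    exact h.convex a b c ha hb hc

namespace IsConsInstance

variable {n k : ℕ} {F : RForest n} {π π' : Pattern k} {v w : Fin k → Fin n}

lemma eq_of_eq_of_add_eq (hv : IsConsInstance F π v) (hw : IsConsInstance F π' w) (t : ℕ) :
    ∀ {a b c d : Fin k}, v a = w b → (c : ℕ) + t = a → (d : ℕ) + t = b → v c = w d := by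
  induction t with
  | zero =>
    intro a b c d h hc hd
    obtain rfl : c = a := Fin.ext hc
    obtain rfl : d = b := Fin.ext hd
    exact h
  | succ t ih =>
    intro a b c d h hc hd
    have h1 := hv.1 ⟨c + t, by omega⟩ a (by simp; omega)
    have h2 := hw.1 ⟨d + t, by omega⟩ b (by simp; omega)
    rw [h, h2] at h1
    exact ih (Option.some.inj h1).symm rfl rfl

lemma position_eq (hv : IsConsInstance F π v) (hw : IsConsInstance F π w) (hπ : π.IsZigzag)
    {a b : Fin k} (h : v a = w b) (ha : 2 ≤ (a : ℕ)) (hb : 2 ≤ (b : ℕ)) : a = b := by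
  wlog hab : a ≤ b generalizing v w a b
  · exact (this hw hv h.symm hb ha (le_of_not_ge hab)).symm
  by_contra hne
  have hlt : (a : ℕ) < b := Fin.lt_def.1 (lt_of_le_of_ne hab hne)
  have key : ∀ c d : Fin k, (c : ℕ) ≤ 2 → (d : ℕ) + a = b + c → v c = w d := fun c d hc hd =>
    hv.eq_of_eq_of_add_eq hw (a - c) h (by omega) (by omega)
  have hlow : ∀ c c' d d' : Fin k, (c : ℕ) ≤ 1 → (c' : ℕ) = c + 1 → (d : ℕ) + a = b + c →
      (d' : ℕ) + a = b + c' → π d < π d' := fun c c' d d' hc hc' hd hd' => by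
    rw [← hw.2, ← key c d (by omega) hd, ← key c' d' (by omega) hd', hv.2]
    exact hπ.low c c' hc (Fin.lt_def.2 (by omega))
  have h01 := hlow ⟨0, by omega⟩ ⟨1, by omega⟩ ⟨b - a, by omega⟩ ⟨b - a + 1, by omega⟩
    (by simp) (by simp) (by simp; omega) (by simp; omega)
  have h12 := hlow ⟨1, by omega⟩ ⟨2, by omega⟩ ⟨b - a + 1, by omega⟩ ⟨b - a + 2, by omega⟩
    (by simp) (by simp) (by simp; omega) (by simp; omega)
  have hodd := hπ.odd ⟨2, by omega⟩
  have heven := hπ.even ⟨2, by omega⟩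
  rcases Nat.even_or_odd' (b - a : ℕ) with ⟨r, hr | hr⟩
  · have h1 := hodd ⟨b - a + 1, by omega⟩ rfl (by simp; omega) (by simp; omega)
    rcases Nat.lt_or_ge (b - a : ℕ) 3 with h3 | h3
    · have : (⟨b - a, by omega⟩ : Fin k) = ⟨2, by omega⟩ := Fin.ext (by simp; omega)
      rw [this] at h01
      exact lt_asymm h1 h01
    · have h2 := heven ⟨b - a, by omega⟩ rfl (by simp; omega) (by simp; omega)
      exact lt_asymm (h1.trans h2) h01
  · have h1 := hodd ⟨b - a + 2, by omega⟩ rfl (by simp; omega) (by simp; omega)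
    rcases Nat.lt_or_ge (b - a + 1 : ℕ) 3 with h3 | h3
    · have : (⟨b - a + 1, by omega⟩ : Fin k) = ⟨2, by omega⟩ := Fin.ext (by simp; omega)
      rw [this] at h12
      exact lt_asymm h1 h12
    · have h2 := heven ⟨b - a + 1, by omega⟩ rfl (by simp; omega) (by simp; omega)
      exact lt_asymm (h1.trans h2) h12

lemma eq_of_le (hv : IsConsInstance F π v) (hw : IsConsInstance F π' w) {a c : Fin k}
    (h : v a = w a) (hc : c ≤ a) : v c = w c :=
  hv.eq_of_eq_of_add_eq hw (a - c : ℕ) h (by have := Fin.le_def.1 hc; omega)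
    (by have := Fin.le_def.1 hc; omega)

end IsConsInstance

namespace RForest

lemma exists_rank {n : ℕ} (F : RForest n) :
    ∃ h : Fin n → ℕ, ∀ a b, F.parent b = some a → h a < h b := by
  classical
  refine ⟨fun b => (Finset.univ.filter fun a => F.SAnc a b).card, fun a b hab => ?_⟩
  apply Finset.card_lt_card
  rw [Finset.ssubset_iff_of_subset]
  · exact ⟨a, Finset.mem_filter.2 ⟨Finset.mem_univ _, Relation.TransGen.single hab⟩,
      fun h => F.acyclic a (Finset.mem_filter.1 h).2⟩
  · intro c hc
    simp only [Finset.mem_filter, Finset.mem_univ, true_and] at hc ⊢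
    exact hc.tail hab

lemma acyclic_of_rank {n : ℕ} {par : Fin n → Option (Fin n)} (h : Fin n → ℕ)
    (hlt : ∀ a b, par b = some a → h a < h b) (v : Fin n) :
    ¬ Relation.TransGen (fun a b => par b = some a) v v := by
  have key : ∀ u w, Relation.TransGen (fun a b => par b = some a) u w → h u < h w := by
    intro u w huw
    induction huw with
    | single h1 => exact hlt _ _ h1
    | tail _ h1 ih => exact ih.trans (hlt _ _ h1)
  exact fun hv => lt_irrefl _ (key v v hv)

lemma ext_parent {n : ℕ} {F G : RForest n} (h : F.parent = G.parent) : F = G := by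
  cases F; cases G; cases h; rfl

instance {n : ℕ} : Finite (RForest n) :=
  Finite.of_injective RForest.parent fun _ _ => ext_parent

end RForest

namespace Marking

variable {n k : ℕ}

/-- `v` and `w` have the same first `i` vertices. -/
def Agree (i : ℕ) (v w : Fin k → Fin n) : Prop := ∀ c : Fin k, (c : ℕ) < i → v c = w c

lemma Agree.symm {i : ℕ} {v w : Fin k → Fin n} (h : Agree i v w) : Agree i w v :=
  fun c hc => (h c hc).symm

lemma Agree.trans {i : ℕ} {u v w : Fin k → Fin n} (h : Agree i u v) (h' : Agree i v w) :
    Agree i u w :=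
  fun c hc => (h c hc).trans (h' c hc)

/-- `y` sits at a position in `Alt i` of a marked sequence. -/
def AtAlt (i : ℕ) (M : Finset (Fin k → Fin n)) (y : Fin n) : Prop :=
  ∃ v ∈ M, ∃ a : Fin k, Pattern.Alt i a ∧ v a = y

/-- `y` sits immediately after a position in `Alt i` of a marked sequence. -/
def AfterAlt (i : ℕ) (M : Finset (Fin k → Fin n)) (y : Fin n) : Prop :=
  ∃ v ∈ M, ∃ a b : Fin k, Pattern.Alt i a ∧ (b : ℕ) = a + 1 ∧ v b = y

open Classical in
/-- The vertices at positions in `Alt i` of the marked sequences that have the same first `i`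
vertices as a marked sequence through `y`. -/
noncomputable def block (i : ℕ) (M : Finset (Fin k → Fin n)) (y : Fin n) : Finset (Fin n) :=
  Finset.univ.filter fun z => ∃ v ∈ M, ∃ w ∈ M, ∃ a b : Fin k,
    Pattern.Alt i a ∧ Pattern.Alt i b ∧ Agree i v w ∧ v a = y ∧ w b = z

/-- Reverse the order of the labels within every block. -/
noncomputable def swap (i : ℕ) (M : Finset (Fin k → Fin n)) (y : Fin n) : Fin n :=
  (block i M y).reverseOn y

open Classical in
/-- The parent function after exchanging the subtrees within every block while keeping the
marked sequences. -/
noncomputable def swapParent (i : ℕ) (F : RForest n) (M : Finset (Fin k → Fin n))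
    (y : Fin n) : Option (Fin n) :=
  if AfterAlt i M y then (F.parent y).map (swap i M) else F.parent (swap i M y)

open Classical in
/-- The image of a marked sequence in the forest with parent function `swapParent`. -/
noncomputable def swapSeq (i : ℕ) (F : RForest n) (M : Finset (Fin k → Fin n))
    (w : Fin k → Fin n) (j : Fin k) : Fin n :=
  if Pattern.Alt i j then swap i M (w j)
  else if h : (j : ℕ) = 0 ∧ 1 < k then (swapParent i F M (w ⟨1, h.2⟩)).getD (w j)
  else w j

section

variable {i : ℕ} {F : RForest n} {π : Pattern k} {M : Finset (Fin k → Fin n)}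

lemma mem_block {y z : Fin n} : z ∈ block i M y ↔ ∃ v ∈ M, ∃ w ∈ M, ∃ a b : Fin k,
    Pattern.Alt i a ∧ Pattern.Alt i b ∧ Agree i v w ∧ v a = y ∧ w b = z := by
  simp [block]

lemma mem_block_of_agree {v w : Fin k → Fin n} {a b : Fin k} (hv : v ∈ M) (hw : w ∈ M)
    (ha : Pattern.Alt i a) (hb : Pattern.Alt i b) (h : Agree i v w) : w b ∈ block i M (v a) :=
  mem_block.2 ⟨v, hv, w, hw, a, b, ha, hb, h, rfl, rfl⟩

lemma swap_of_not_atAlt {y : Fin n} (h : ¬ AtAlt i M y) : swap i M y = y := by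
  apply Finset.reverseOn_of_notMem
  rw [mem_block]
  rintro ⟨v, hv, w, hw, a, b, ha, hb, -, hy, -⟩
  exact h ⟨v, hv, a, ha, hy⟩

variable (hM : ∀ w ∈ M, IsConsInstance F π w) (hπ : π.IsZigzag) (hi : 3 ≤ i)
include hM hπ hi

lemma agree_of_eq {v w : Fin k → Fin n} {a b : Fin k} (hv : v ∈ M) (hw : w ∈ M)
    (ha : i ≤ (a : ℕ)) (hb : i ≤ (b : ℕ)) (h : v a = w b) : Agree i v w := by
  obtain rfl := (hM v hv).position_eq (hM w hw) hπ h (by omega) (by omega)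
  exact fun c hc => (hM v hv).eq_of_le (hM w hw) h (Fin.le_def.2 (by omega))

lemma block_eq_of_agree {v w : Fin k → Fin n} {a b : Fin k} (hv : v ∈ M) (hw : w ∈ M)
    (ha : Pattern.Alt i a) (hb : Pattern.Alt i b) (h : Agree i v w) :
    block i M (v a) = block i M (w b) := by
  ext z
  rw [mem_block, mem_block]
  constructor
  · rintro ⟨v', hv', w', hw', a', b', ha', hb', h', hy, hz⟩
    have := agree_of_eq hM hπ hi hv' hv ha'.1 ha.1 hy
    exact ⟨w, hw, w', hw', b, b', hb, hb', h.symm.trans (this.symm.trans h'), rfl, hz⟩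
  · rintro ⟨v', hv', w', hw', a', b', ha', hb', h', hy, hz⟩
    have := agree_of_eq hM hπ hi hv' hw ha'.1 hb.1 hy
    exact ⟨v, hv, w', hw', a, b', ha, hb', h.trans (this.symm.trans h'), rfl, hz⟩

lemma exists_eq_swap {v : Fin k → Fin n} {a : Fin k} (hv : v ∈ M) (ha : Pattern.Alt i a) :
    ∃ w ∈ M, ∃ b, Pattern.Alt i b ∧ Agree i w v ∧ w b = swap i M (v a) := by
  have h := Finset.reverseOn_mem (mem_block_of_agree hv hv ha ha fun _ _ => rfl)
  obtain ⟨v', hv', w, hw, a', b, ha', hb, h', hy, hz⟩ := mem_block.1 h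
  exact ⟨w, hw, b, hb,
    h'.symm.trans (agree_of_eq hM hπ hi hv' hv ha'.1 ha.1 hy), hz⟩

lemma swap_swap (y : Fin n) : swap i M (swap i M y) = y := by
  by_cases h : AtAlt i M y
  · obtain ⟨v, hv, a, ha, rfl⟩ := h
    obtain ⟨w, hw, b, hb, hvw, heq⟩ := exists_eq_swap hM hπ hi hv ha
    rw [← heq, swap, block_eq_of_agree hM hπ hi hw hv hb ha hvw, heq, swap,
      Finset.reverseOn_reverseOn]
  · rw [swap_of_not_atAlt h, swap_of_not_atAlt h]

lemma swap_lt_swap {v w : Fin k → Fin n} {a b : Fin k} (hv : v ∈ M) (hw : w ∈ M)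
    (ha : Pattern.Alt i a) (hb : Pattern.Alt i b) (h : Agree i v w) :
    swap i M (v a) < swap i M (w b) ↔ w b < v a := by
  rw [swap, swap, ← block_eq_of_agree hM hπ hi hv hw ha hb h]
  exact Finset.reverseOn_lt_reverseOn (mem_block_of_agree hv hv ha ha fun _ _ => rfl)
    (mem_block_of_agree hv hw ha hb h)

lemma atAlt_swap {y : Fin n} (h : AtAlt i M y) : AtAlt i M (swap i M y) := by
  obtain ⟨v, hv, a, ha, rfl⟩ := h
  obtain ⟨w, hw, b, hb, -, heq⟩ := exists_eq_swap hM hπ hi hv ha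
  exact ⟨w, hw, b, hb, heq⟩

lemma atAlt_iff {v : Fin k → Fin n} {a : Fin k} (hv : v ∈ M) (ha : 2 ≤ (a : ℕ)) :
    AtAlt i M (v a) ↔ Pattern.Alt i a := by
  refine ⟨?_, fun h => ⟨v, hv, a, h, rfl⟩⟩
  rintro ⟨w, hw, b, hb, h⟩
  have := hb.1
  rwa [← (hM w hw).position_eq (hM v hv) hπ h (by omega) ha]

lemma afterAlt_iff {v : Fin k → Fin n} {a b : Fin k} (hv : v ∈ M) (ha : 1 ≤ (a : ℕ))
    (hab : (b : ℕ) = a + 1) : AfterAlt i M (v b) ↔ Pattern.Alt i a := by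
  refine ⟨?_, fun h => ⟨v, hv, a, b, h, hab, rfl⟩⟩
  rintro ⟨w, hw, a', b', ha', hab', h⟩
  have := ha'.1
  have := (hM w hw).position_eq (hM v hv) hπ h (by omega) (by omega)
  obtain rfl : a' = a := Fin.ext (by omega)
  exact ha'

lemma not_afterAlt_of_atAlt {y : Fin n} (h : AtAlt i M y) : ¬ AfterAlt i M y := by
  rintro ⟨v, hv, a, b, ha, hab, rfl⟩
  have h1 := ha.1
  have h2 := ((atAlt_iff hM hπ hi hv (by omega)).1 h).2
  have h3 := ha.2
  omega

lemma afterAlt_swap (y : Fin n) : AfterAlt i M (swap i M y) ↔ AfterAlt i M y := by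
  by_cases h : AtAlt i M y
  · exact iff_of_false (not_afterAlt_of_atAlt hM hπ hi (atAlt_swap hM hπ hi h))
      (not_afterAlt_of_atAlt hM hπ hi h)
  · rw [swap_of_not_atAlt h]

lemma swapParent_of_alt_succ {v : Fin k → Fin n} {a b : Fin k} (hv : v ∈ M)
    (hb : Pattern.Alt i b) (hab : (b : ℕ) = a + 1) :
    swapParent i F M (swap i M (v b)) = some (v a) := by
  have h : AtAlt i M (v b) := ⟨v, hv, b, hb, rfl⟩
  rw [swapParent, if_neg (not_afterAlt_of_atAlt hM hπ hi (atAlt_swap hM hπ hi h)),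
    swap_swap hM hπ hi, (hM v hv).1 a b hab]

omit hπ hi in
lemma swapParent_of_alt {v : Fin k → Fin n} {a b : Fin k} (hv : v ∈ M)
    (ha : Pattern.Alt i a) (hab : (b : ℕ) = a + 1) :
    swapParent i F M (v b) = some (swap i M (v a)) := by
  rw [swapParent, if_pos ⟨v, hv, a, b, ha, hab, rfl⟩, (hM v hv).1 a b hab, Option.map_some]

lemma swapParent_of_not_alt {v : Fin k → Fin n} {a b : Fin k} (hv : v ∈ M) (h1 : 1 ≤ (a : ℕ))
    (ha : ¬ Pattern.Alt i a) (hb : ¬ Pattern.Alt i b) (hab : (b : ℕ) = a + 1) :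
    swapParent i F M (v b) = some (v a) := by
  rw [swapParent, if_neg (fun h => ha ((afterAlt_iff hM hπ hi hv h1 hab).1 h)),
    swap_of_not_atAlt (fun h => hb ((atAlt_iff hM hπ hi hv (by omega)).1 h)),
    (hM v hv).1 a b hab]

lemma lt_swap_iff (hπ' : ∃ π', Pattern.IsReversal i π π') {v : Fin k → Fin n} {a b : Fin k}
    (hv : v ∈ M) (ha : ¬ Pattern.Alt i a) (hb : Pattern.Alt i b) :
    (v a < swap i M (v b) ↔ π a < π b) ∧ (swap i M (v b) < v a ↔ π b < π a) := by
  obtain ⟨π', hr⟩ := hπ'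
  obtain ⟨w, hw, c, hc, hwv, heq⟩ := exists_eq_swap hM hπ hi hv hb
  have hconv := hr.convex a b c ha hb hc
  have hconv' : π b < π a ↔ π c < π a := by
    have hne : ∀ d, Pattern.Alt i d → π d ≠ π a := fun d hd h =>
      ha (π.injective h ▸ hd)
    rw [← not_iff_not, not_lt, not_lt, le_iff_lt_or_eq, le_iff_lt_or_eq, hconv]
    simp [(hne b hb).symm, (hne c hc).symm]
  rw [← heq]
  rcases Nat.lt_or_ge a i with hai | hai
  · rw [← hwv a hai, (hM w hw).2, (hM w hw).2, hconv, hconv']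
    exact ⟨Iff.rfl, Iff.rfl⟩
  · have hb1 := hb.1
    have hb2 := hb.2
    have hc1 := hc.1
    have hc2 := hc.2
    have ha2 : (a : ℕ) % 2 ≠ i % 2 := fun h => ha ⟨hai, h⟩
    have h2 := hwv ⟨2, by omega⟩ (by simp; omega)
    rcases Nat.mod_two_eq_zero_or_one i with hi2 | hi2
    · have h3 := hπ.odd ⟨2, by omega⟩ a rfl (by omega) (by omega)
      have h4 := hπ.even ⟨2, by omega⟩ b rfl (by omega) (by omega)
      have h5 := hπ.even ⟨2, by omega⟩ c rfl (by omega) (by omega)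
      have h6 := ((hM v hv).2 _ _).2 h3
      have h7 := ((hM w hw).2 _ _).2 h5
      rw [h2] at h7
      exact ⟨iff_of_true (h6.trans h7) (h3.trans h4),
        iff_of_false (h6.trans h7).not_gt (h3.trans h4).not_gt⟩
    · have h3 := hπ.even ⟨2, by omega⟩ a rfl (by omega) (by omega)
      have h4 := hπ.odd ⟨2, by omega⟩ b rfl (by omega) (by omega)
      have h5 := hπ.odd ⟨2, by omega⟩ c rfl (by omega) (by omega)
      have h6 := ((hM v hv).2 _ _).2 h3
      have h7 := ((hM w hw).2 _ _).2 h5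
      rw [h2] at h7
      exact ⟨iff_of_false (h7.trans h6).not_gt (h4.trans h3).not_gt,
        iff_of_true (h7.trans h6) (h4.trans h3)⟩

lemma exists_swapParent_lt (hπ' : ∃ π', Pattern.IsReversal i π π') {v : Fin k → Fin n}
    {a b : Fin k} (hv : v ∈ M) (ha : (a : ℕ) = 0) (hb : (b : ℕ) = 1) :
    ∃ x, swapParent i F M (v b) = some x ∧ x < v b := by
  have hpar := (hM v hv).1 a b (by omega)
  have hlt : v a < v b := ((hM v hv).2 a b).2
    (hπ.low a b (by omega) (Fin.lt_def.2 (by omega)))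
  by_cases hP : AfterAlt i M (v b)
  · obtain ⟨w, hw, c, d, hc, hcd, h⟩ := hP
    have hd : ¬ Pattern.Alt i d := fun hd => by
      have := hd.2
      have := hc.2
      omega
    have hpar' := (hM w hw).1 c d hcd
    rw [h, hpar] at hpar'
    rw [Option.some.inj hpar', ← h, (hM w hw).2] at hlt
    rw [← h]
    exact ⟨_, swapParent_of_alt hM hw hc hcd, ((lt_swap_iff hM hπ hi hπ' hw hd hc).2).2 hlt⟩
  by_cases hR : AtAlt i M (v b)
  · obtain ⟨w, hw, d, hd, h⟩ := hR
    have hd1 := hd.1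
    have hd2 := hd.2
    obtain ⟨c, hc⟩ : ∃ c : Fin k, (d : ℕ) = c + 1 := ⟨⟨d - 1, by omega⟩, by simp; omega⟩
    have hpar' := (hM w hw).1 c d hc
    rw [h, hpar] at hpar'
    rw [Option.some.inj hpar', ← h, (hM w hw).2] at hlt
    have hieven : i % 2 = 0 := by
      by_contra hodd
      have h1 := hπ.odd ⟨2, by omega⟩ d rfl (by omega) (by omega)
      rcases Nat.lt_or_ge c 3 with hc3 | hc3
      · have hc2 : c = ⟨2, by omega⟩ := Fin.ext (by simp; omega)
        rw [hc2] at hlt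
        exact lt_asymm h1 hlt
      · exact lt_asymm (h1.trans (hπ.even ⟨2, by omega⟩ c rfl (by omega) (by omega))) hlt
    obtain ⟨u, hu, l, hl, huw, heq⟩ := exists_eq_swap hM hπ hi hw hd
    have hl1 := hl.1
    have hl2 := hl.2
    obtain ⟨m, hm⟩ : ∃ m : Fin k, (l : ℕ) = m + 1 := ⟨⟨l - 1, by omega⟩, by simp; omega⟩
    have hwd : w d = swap i M (u l) := by rw [heq, swap_swap hM hπ hi]
    rw [← h, hwd]
    refine ⟨u m, swapParent_of_alt_succ hM hπ hi hu hl hm, ?_⟩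
    refine ((lt_swap_iff hM hπ hi hπ' hu (fun h => ?_) hl).1).2 ?_
    · have := h.2
      omega
    · exact (hπ.odd ⟨2, by omega⟩ m rfl (by omega) (by omega)).trans
        (hπ.even ⟨2, by omega⟩ l rfl (by omega) (by omega))
  · exact ⟨v a, by rw [swapParent, if_neg hP, swap_of_not_atAlt hR, hpar], hlt⟩

omit hπ hi in
lemma rank_lt {h : Fin n → ℕ} (hh : ∀ a b, F.parent b = some a → h a < h b)
    {v : Fin k → Fin n} (hv : v ∈ M) {a b : Fin k} (hab : a < b) : h (v a) < h (v b) := by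
  obtain ⟨b, hb⟩ := b
  induction b with
  | zero => exact absurd hab (by simp [Fin.lt_def])
  | succ b ih =>
    have h1 := hh _ _ ((hM v hv).1 ⟨b, by omega⟩ ⟨b + 1, hb⟩ rfl)
    have h2 : (a : ℕ) < b + 1 := hab
    rcases Nat.lt_succ_iff_lt_or_eq.1 h2 with h3 | h3
    · exact (ih (by omega) h3).trans h1
    · have ha : a = ⟨b, by omega⟩ := Fin.ext h3
      rwa [ha]

lemma exists_agree_of_swap_eq {v : Fin k → Fin n} {a : Fin k} {y : Fin n} (hv : v ∈ M)
    (ha : i ≤ (a : ℕ)) (h : v a = swap i M y) :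
    ∃ w ∈ M, ∃ b : Fin k, i ≤ (b : ℕ) ∧ Agree i w v ∧ w b = y := by
  by_cases hy : AtAlt i M y
  · have h1 := atAlt_swap hM hπ hi hy
    rw [← h, atAlt_iff hM hπ hi hv (by omega)] at h1
    obtain ⟨w, hw, b, hb, hwv, heq⟩ := exists_eq_swap hM hπ hi hv h1
    exact ⟨w, hw, b, hb.1, hwv, by rw [heq, h, swap_swap hM hπ hi]⟩
  · exact ⟨v, hv, a, ha, fun _ _ => rfl, by rw [h, swap_of_not_atAlt hy]⟩

lemma swapParent_acyclic (y : Fin n) :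
    ¬ Relation.TransGen (fun a b => swapParent i F M b = some a) y y := by
  obtain ⟨h, hh⟩ := F.exists_rank
  have hex : ∀ y, ∃ r : ℕ,
      (∀ v ∈ M, ∀ a c : Fin k, i ≤ (a : ℕ) → (c : ℕ) + 1 = i → v a = swap i M y →
        r = (k + 1) * h (v c) + a) ∧
      ((∀ v ∈ M, ∀ a : Fin k, i ≤ (a : ℕ) → v a ≠ swap i M y) → r = (k + 1) * h y) := by
    intro y
    by_cases hy : ∃ v ∈ M, ∃ a : Fin k, i ≤ (a : ℕ) ∧ v a = swap i M y
    · obtain ⟨v, hv, a, ha, h1⟩ := hy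
      refine ⟨(k + 1) * h (v ⟨i - 1, by omega⟩) + a, fun w hw b c hb hc h2 => ?_,
        fun h2 => absurd h1 (h2 v hv a ha)⟩
      have h3 := agree_of_eq hM hπ hi hv hw ha hb (h1.trans h2.symm)
      have h4 := (hM v hv).position_eq (hM w hw) hπ (h1.trans h2.symm) (by omega) (by omega)
      have h5 : c = ⟨i - 1, by omega⟩ := Fin.ext (by simp; omega)
      rw [h5, h3 _ (by simp; omega), congrArg Fin.val h4]
    · exact ⟨(k + 1) * h y, fun w hw b c hb hc h2 => absurd ⟨w, hw, b, hb, h2⟩ hy, fun _ => rfl⟩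
  choose r hr1 hr2 using hex
  refine RForest.acyclic_of_rank r (fun x y hxy => ?_) y
  by_cases hP : AfterAlt i M y
  · have hR : ¬ AtAlt i M y := fun h => not_afterAlt_of_atAlt hM hπ hi h hP
    obtain ⟨v, hv, a, b, ha, hab, rfl⟩ := hP
    have hi' := ha.1
    rw [swapParent_of_alt hM hv ha hab] at hxy
    obtain rfl := Option.some.inj hxy
    rw [hr1 _ v hv a ⟨i - 1, by omega⟩ ha.1 (by simp; omega) (by rw [swap_swap hM hπ hi]),
      hr1 _ v hv b ⟨i - 1, by omega⟩ (by omega) (by simp; omega) (by rw [swap_of_not_atAlt hR])]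
    omega
  by_cases hR : AtAlt i M y
  · obtain ⟨v, hv, a, ha, heq⟩ := atAlt_swap hM hπ hi hR
    have ha1 := ha.1
    have ha2 := ha.2
    obtain ⟨b, hb⟩ : ∃ b : Fin k, (a : ℕ) = b + 1 := ⟨⟨a - 1, by omega⟩, by simp; omega⟩
    have hbalt : ¬ Pattern.Alt i b := fun h => by
      have := h.2
      omega
    have hbR : ¬ AtAlt i M (v b) := fun h => hbalt ((atAlt_iff hM hπ hi hv (by omega)).1 h)
    have hy : y = swap i M (v a) := by rw [heq, swap_swap hM hπ hi]
    rw [hy, swapParent_of_alt_succ hM hπ hi hv ha hb] at hxy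
    obtain rfl := Option.some.inj hxy
    rw [hr1 y v hv a ⟨i - 1, by omega⟩ ha1 (by simp; omega) heq]
    rcases Nat.lt_or_ge b i with hbi | hbi
    · have : b = ⟨i - 1, by omega⟩ := Fin.ext (by simp; omega)
      rw [hr2 (v b), ← this]
      · omega
      · intro w hw c hc h1
        rw [swap_of_not_atAlt hbR] at h1
        have := (hM w hw).position_eq (hM v hv) hπ h1 (by omega) (by omega)
        omega
    · rw [hr1 (v b) v hv b ⟨i - 1, by omega⟩ hbi (by simp; omega)
        (by rw [swap_of_not_atAlt hbR])]
      omega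
  · rw [swapParent, if_neg hP, swap_of_not_atAlt hR] at hxy
    have h1 := hh _ _ hxy
    have hy : r y = (k + 1) * h y := by
      refine hr2 y fun v hv a ha h2 => ?_
      rw [swap_of_not_atAlt hR] at h2
      rw [← h2] at hP hR
      obtain ⟨b, hb⟩ : ∃ b : Fin k, (a : ℕ) = b + 1 := ⟨⟨a - 1, by omega⟩, by simp; omega⟩
      rw [atAlt_iff hM hπ hi hv (by omega)] at hR
      rw [afterAlt_iff hM hπ hi hv (by omega) hb] at hP
      have h3 : (a : ℕ) % 2 ≠ i % 2 := fun h => hR ⟨ha, h⟩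
      refine hP ⟨?_, by omega⟩
      by_contra h4
      exact h3 (by rw [show (a : ℕ) = i by omega])
    by_cases hx : ∃ v ∈ M, ∃ a : Fin k, i ≤ (a : ℕ) ∧ v a = swap i M x
    · obtain ⟨v, hv, a, ha, h2⟩ := hx
      obtain ⟨w, hw, b, hb, hwv, h3⟩ := exists_agree_of_swap_eq hM hπ hi hv ha h2
      have h4 : h (w ⟨i - 1, by omega⟩) < h (w b) :=
        rank_lt hM hh hw (Fin.lt_def.2 (by simp; omega))
      rw [h3, hwv _ (by simp; omega)] at h4
      rw [hr1 x v hv a ⟨i - 1, by omega⟩ ha (by simp; omega) h2, hy]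
      have h5 : (k + 1) * (h (v ⟨i - 1, by omega⟩) + 1) ≤ (k + 1) * h y := Nat.mul_le_mul_left (k + 1) (by omega)
      have := a.isLt
      rw [Nat.mul_add] at h5
      omega
    · rw [hr2 x fun v hv a ha h2 => hx ⟨v, hv, a, ha, h2⟩, hy]
      exact Nat.mul_lt_mul_of_pos_left h1 k.succ_pos

end

end Marking

namespace Marking

variable {n k i : ℕ} {F : RForest n} {π π' : Pattern k} {M : Finset (Fin k → Fin n)}

open Classical in
/-- The marked sequences after exchanging subtrees. -/
noncomputable def swapMarks (i : ℕ) (F : RForest n) (M : Finset (Fin k → Fin n)) :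
    Finset (Fin k → Fin n) :=
  M.image (swapSeq i F M)

open Classical in
/-- The forest with parent function `swapParent`, whenever this function is acyclic. -/
noncomputable def swapForest (i : ℕ) (F : RForest n) (M : Finset (Fin k → Fin n)) : RForest n :=
  if h : ∀ y, ¬ Relation.TransGen (fun a b => swapParent i F M b = some a) y y then
    ⟨swapParent i F M, h⟩
  else F

lemma swapSeq_of_alt {w : Fin k → Fin n} {j : Fin k} (hj : Pattern.Alt i j) :
    swapSeq i F M w j = swap i M (w j) := if_pos hj

lemma swapSeq_of_not_alt {w : Fin k → Fin n} {j : Fin k} (hj : ¬ Pattern.Alt i j)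
    (h1 : 1 ≤ (j : ℕ)) : swapSeq i F M w j = w j := by
  rw [swapSeq, if_neg hj, dif_neg fun h => by omega]

variable (hM : ∀ w ∈ M, IsConsInstance F π w) (hi : 3 ≤ i) (hr : Pattern.IsReversal i π π')
include hM hi hr

lemma swapForest_parent : (swapForest i F M).parent = swapParent i F M := by
  rw [swapForest, dif_pos (swapParent_acyclic hM hr.left hi)]

lemma swapSeq_zero {w : Fin k → Fin n} {a b : Fin k} (hw : w ∈ M) (ha : (a : ℕ) = 0)
    (hb : (b : ℕ) = 1) : swapParent i F M (w b) = some (swapSeq i F M w a) ∧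
      swapSeq i F M w a < w b := by
  obtain ⟨x, hx, hlt⟩ := exists_swapParent_lt hM hr.left hi ⟨π', hr⟩ hw ha hb
  have hbk := b.isLt
  have hb1 : b = ⟨1, by omega⟩ := Fin.ext hb
  have h0 : swapSeq i F M w a = x := by
    rw [swapSeq, if_neg fun h => by have := h.1; omega, dif_pos ⟨ha, by omega⟩, ← hb1, hx,
      Option.getD_some]
  rw [h0]
  exact ⟨hx, hlt⟩

lemma swapSeq_lt {w : Fin k → Fin n} (hw : w ∈ M) {a b : Fin k} (hab : π' a < π' b) :
    swapSeq i F M w a < swapSeq i F M w b := by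
  have hpos : ∀ a b : Fin k, 1 ≤ (a : ℕ) → 1 ≤ (b : ℕ) → π' a < π' b →
      swapSeq i F M w a < swapSeq i F M w b := by
    intro a b ha0 hb0 hab
    by_cases ha : Pattern.Alt i a <;> by_cases hb : Pattern.Alt i b
    · rw [swapSeq_of_alt ha, swapSeq_of_alt hb,
        swap_lt_swap hM hr.left hi hw hw ha hb fun _ _ => rfl, (hM w hw).2,
        ← hr.reversed a b ha hb]
      exact hab
    · rw [swapSeq_of_alt ha, swapSeq_of_not_alt hb hb0,
        (lt_swap_iff hM hr.left hi ⟨π', hr⟩ hw hb ha).2, ← hr.same a b fun h => hb h.2]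
      exact hab
    · rw [swapSeq_of_not_alt ha ha0, swapSeq_of_alt hb,
        (lt_swap_iff hM hr.left hi ⟨π', hr⟩ hw ha hb).1, ← hr.same a b fun h => ha h.1]
      exact hab
    · rw [swapSeq_of_not_alt ha ha0, swapSeq_of_not_alt hb hb0, (hM w hw).2,
        ← hr.same a b fun h => ha h.1]
      exact hab
  have hb0 : (b : ℕ) ≠ 0 := fun hb => by
    rcases Nat.eq_zero_or_pos (a : ℕ) with ha | ha
    · rw [Fin.ext (ha.trans hb.symm)] at hab
      exact lt_irrefl _ hab
    · exact lt_asymm hab (hr.right.low b a (by omega) (Fin.lt_def.2 (by omega)))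
  rcases Nat.eq_zero_or_pos (a : ℕ) with ha | ha
  · have hbk := b.isLt
    have h1 := (swapSeq_zero hM hi hr hw ha (b := ⟨1, by omega⟩) rfl).2
    have h2 : ¬ Pattern.Alt i (⟨1, by omega⟩ : Fin k) := fun h => by
      have h3 : i ≤ 1 := h.1
      omega
    rw [← swapSeq_of_not_alt (F := F) (M := M) (w := w) h2 le_rfl] at h1
    rcases Nat.eq_or_lt_of_le (Nat.pos_of_ne_zero hb0) with hb | hb
    · rwa [show b = ⟨1, by omega⟩ from Fin.ext hb.symm]
    · exact h1.trans (hpos _ _ le_rfl (by omega)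
        (hr.right.low _ _ le_rfl (Fin.lt_def.2 hb)))
  · exact hpos a b ha (by omega) hab

lemma isConsInstance_swapSeq {w : Fin k → Fin n} (hw : w ∈ M) :
    IsConsInstance (swapForest i F M) π' (swapSeq i F M w) := by
  refine ⟨fun a b hab => ?_, fun a b => ⟨fun h => ?_, swapSeq_lt hM hi hr hw⟩⟩
  · rw [swapForest_parent hM hi hr]
    rcases Nat.eq_zero_or_pos (a : ℕ) with ha0 | ha0
    · rw [swapSeq_of_not_alt (fun h => by have := h.1; omega) (by omega)]
      exact (swapSeq_zero hM hi hr hw ha0 (by omega)).1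
    by_cases hb : Pattern.Alt i b
    · rw [swapSeq_of_alt hb, swapSeq_of_not_alt (fun h => ?_) ha0,
        swapParent_of_alt_succ hM hr.left hi hw hb hab]
      have h1 := h.2
      have h2 := hb.2
      omega
    rw [swapSeq_of_not_alt hb (by omega)]
    by_cases ha : Pattern.Alt i a
    · rw [swapSeq_of_alt ha, swapParent_of_alt hM hw ha hab]
    · rw [swapSeq_of_not_alt ha ha0, swapParent_of_not_alt hM hr.left hi hw ha0 ha hb hab]
  · by_contra hab
    rcases lt_or_eq_of_le (not_lt.1 hab) with h1 | h1
    · exact lt_asymm h (swapSeq_lt hM hi hr hw h1)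
    · rw [π'.injective h1] at h
      exact lt_irrefl _ h

lemma isConsInstance_of_mem_swapMarks :
    ∀ w ∈ swapMarks i F M, IsConsInstance (swapForest i F M) π' w := by
  intro w hw
  obtain ⟨v, hv, rfl⟩ := Finset.mem_image.1 hw
  exact isConsInstance_swapSeq hM hi hr hv

omit hr in
lemma agree_swapSeq {v w : Fin k → Fin n} (hv : v ∈ M) (hw : w ∈ M) :
    Agree i (swapSeq i F M v) (swapSeq i F M w) ↔ Agree i v w := by
  have hpos : ∀ c : Fin k, (c : ℕ) < i → 1 ≤ (c : ℕ) → ∀ u, swapSeq i F M u c = u c :=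
    fun c hc h1 u => swapSeq_of_not_alt (fun h => by have := h.1; omega) h1
  constructor
  · intro h c hc
    rcases Nat.eq_zero_or_pos (c : ℕ) with h0 | h0
    · by_cases hk : 1 < k
      · have h1 := h ⟨1, hk⟩ (by simp; omega)
        rw [hpos ⟨1, hk⟩ (by simp; omega) le_rfl, hpos ⟨1, hk⟩ (by simp; omega) le_rfl] at h1
        exact (hM v hv).eq_of_eq_of_add_eq (hM w hw) 1 h1 (show _ = 1 by omega)
          (show _ = 1 by omega)
      · have h1 := h c hc
        rwa [swapSeq, swapSeq, if_neg (fun h => by have := h.1; omega),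
          if_neg (fun h => by have := h.1; omega), dif_neg (fun h => hk h.2),
          dif_neg (fun h => hk h.2)] at h1
    · rw [← hpos c hc h0 v, ← hpos c hc h0 w]
      exact h c hc
  · intro h c hc
    have hc' : ¬ Pattern.Alt i c := fun h => by have := h.1; omega
    rw [swapSeq, swapSeq, if_neg hc', if_neg hc', h c hc]
    by_cases h0 : (c : ℕ) = 0 ∧ 1 < k
    · rw [dif_pos h0, dif_pos h0, h ⟨1, h0.2⟩ (by simp; omega)]
    · rw [dif_neg h0, dif_neg h0]

omit hM hi hr in
lemma afterAlt_swapMarks (y : Fin n) : AfterAlt i (swapMarks i F M) y ↔ AfterAlt i M y := by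
  have key : ∀ v, ∀ a b : Fin k, Pattern.Alt i a → (b : ℕ) = a + 1 →
      swapSeq i F M v b = v b := fun v a b ha hab =>
    swapSeq_of_not_alt (fun h => by have h1 := h.2; have h2 := ha.2; omega) (by omega)
  constructor
  · rintro ⟨w, hw, a, b, ha, hab, rfl⟩
    obtain ⟨v, hv, rfl⟩ := Finset.mem_image.1 hw
    exact ⟨v, hv, a, b, ha, hab, (key v a b ha hab).symm⟩
  · rintro ⟨v, hv, a, b, ha, hab, rfl⟩
    exact ⟨_, Finset.mem_image_of_mem _ hv, a, b, ha, hab, key v a b ha hab⟩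

lemma block_swapMarks (y : Fin n) : block i (swapMarks i F M) y = block i M y := by
  ext z
  constructor
  · intro hz
    obtain ⟨v', hv', w', hw', a, b, ha, hb, h, rfl, rfl⟩ := mem_block.1 hz
    obtain ⟨v, hv, rfl⟩ := Finset.mem_image.1 hv'
    obtain ⟨w, hw, rfl⟩ := Finset.mem_image.1 hw'
    rw [swapSeq_of_alt ha, swapSeq_of_alt hb]
    obtain ⟨u, hu, c, hc, huv, hceq⟩ := exists_eq_swap hM hr.left hi hv ha
    obtain ⟨x, hx, d, hd, hxw, hdeq⟩ := exists_eq_swap hM hr.left hi hw hb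
    rw [← hceq, ← hdeq]
    exact mem_block_of_agree hu hx hc hd
      (huv.trans (((agree_swapSeq hM hi hv hw).1 h).trans hxw.symm))
  · intro hz
    obtain ⟨v, hv, w, hw, a, b, ha, hb, h, rfl, rfl⟩ := mem_block.1 hz
    obtain ⟨u, hu, c, hc, huv, hceq⟩ := exists_eq_swap hM hr.left hi hv ha
    obtain ⟨x, hx, d, hd, hxw, hdeq⟩ := exists_eq_swap hM hr.left hi hw hb
    refine mem_block.2 ⟨_, Finset.mem_image_of_mem _ hu, _, Finset.mem_image_of_mem _ hx, c, d,
      hc, hd, (agree_swapSeq hM hi hu hx).2 (huv.trans (h.trans hxw.symm)), ?_, ?_⟩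
    · rw [swapSeq_of_alt hc, hceq, swap_swap hM hr.left hi]
    · rw [swapSeq_of_alt hd, hdeq, swap_swap hM hr.left hi]

lemma swap_swapMarks (y : Fin n) : swap i (swapMarks i F M) y = swap i M y := by
  rw [swap, swap, block_swapMarks hM hi hr]

lemma swapParent_swapMarks (y : Fin n) :
    swapParent i (swapForest i F M) (swapMarks i F M) y = F.parent y := by
  have hfun : swap i (swapMarks i F M) = swap i M := funext (swap_swapMarks hM hi hr)
  rw [swapParent, swapForest_parent hM hi hr, hfun]
  by_cases h : AfterAlt i M y
  · have : swap i M ∘ swap i M = id := funext (swap_swap hM hr.left hi)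
    rw [if_pos ((afterAlt_swapMarks y).2 h), swapParent, if_pos h, Option.map_map, this,
      Option.map_id, id]
  · rw [if_neg ((afterAlt_swapMarks y).not.2 h), swapParent,
      if_neg ((afterAlt_swap hM hr.left hi y).not.2 h), swap_swap hM hr.left hi]

lemma swapForest_swapForest : swapForest i (swapForest i F M) (swapMarks i F M) = F :=
  RForest.ext_parent <| by
    rw [swapForest_parent (isConsInstance_of_mem_swapMarks hM hi hr) hi hr.symm]
    exact funext (swapParent_swapMarks hM hi hr)

lemma swapSeq_swapSeq {w : Fin k → Fin n} (hw : w ∈ M) :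
    swapSeq i (swapForest i F M) (swapMarks i F M) (swapSeq i F M w) = w := by
  funext j
  by_cases hj : Pattern.Alt i j
  · rw [swapSeq_of_alt hj, swap_swapMarks hM hi hr, swapSeq_of_alt hj, swap_swap hM hr.left hi]
  rcases Nat.eq_zero_or_pos (j : ℕ) with h0 | h0
  · by_cases hk : 1 < k
    · have h1 : ¬ Pattern.Alt i (⟨1, hk⟩ : Fin k) := fun h => by
        have h3 : i ≤ 1 := h.1
        omega
      rw [swapSeq, if_neg hj, dif_pos ⟨h0, hk⟩, swapParent_swapMarks hM hi hr,
        swapSeq_of_not_alt h1 le_rfl, (hM w hw).1 j ⟨1, hk⟩ (by simp; omega),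
        Option.getD_some]
    · rw [swapSeq, if_neg hj, dif_neg (fun h => hk h.2), swapSeq, if_neg hj,
        dif_neg (fun h => hk h.2)]
  · rw [swapSeq_of_not_alt hj h0, swapSeq_of_not_alt hj h0]

lemma swapMarks_swapMarks : swapMarks i (swapForest i F M) (swapMarks i F M) = M := by
  classical
  conv_lhs => rw [swapMarks, swapMarks]
  rw [Finset.image_image]
  conv_rhs => rw [← Finset.image_id (s := M)]
  exact Finset.image_congr fun w hw => swapSeq_swapSeq hM hi hr hw

lemma card_swapMarks : (swapMarks i F M).card = M.card := by
  apply le_antisymm Finset.card_image_le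
  conv_lhs => rw [← swapMarks_swapMarks hM hi hr]
  exact Finset.card_image_le

end Marking

lemma RForest.sum_marks {n k : ℕ} [Fintype (RForest n)] (π : Pattern k)
    [DecidablePred fun p : RForest n × Finset (Fin k → Fin n) =>
      ∀ w ∈ p.2, IsConsInstance p.1 π w] :
    (cCount π n : ℤ) = ∑ p : RForest n × Finset (Fin k → Fin n) with
      ∀ w ∈ p.2, IsConsInstance p.1 π w, (-1) ^ p.2.card := by
  classical
  rw [Finset.sum_filter, Fintype.sum_prod_type, cCount, Nat.card_eq_fintype_card,
    Fintype.card_subtype, Finset.card_filter, Nat.cast_sum]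
  refine Finset.sum_congr rfl fun F _ => ?_
  have h : (Finset.univ.filter fun M : Finset (Fin k → Fin n) =>
      ∀ w ∈ M, IsConsInstance F π w) = (Finset.univ.filter (IsConsInstance F π)).powerset := by
    ext M
    simp [Finset.subset_iff]
  rw [← Finset.sum_filter]
  trans ∑ M ∈ (Finset.univ.filter (IsConsInstance F π)).powerset, (-1 : ℤ) ^ M.card
  · rw [Finset.sum_powerset_neg_one_pow_card]
    simp [CContainsPat, Finset.filter_eq_empty_iff]
  · rw [← h]
    exact Finset.sum_congr (Finset.filter_congr fun _ _ => Iff.rfl) fun _ _ => rfl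

lemma Pattern.IsReversal.cForestWilfEquiv {k i : ℕ} {π π' : Pattern k}
    (hr : Pattern.IsReversal i π π') (hi : 3 ≤ i) : CForestWilfEquiv π π' := by
  classical
  intro n
  let _ := Fintype.ofFinite (RForest n)
  rw [← Nat.cast_inj (R := ℤ), RForest.sum_marks, RForest.sum_marks]
  let f : RForest n × Finset (Fin k → Fin n) → RForest n × Finset (Fin k → Fin n) := fun p =>
    (Marking.swapForest i p.1 p.2, Marking.swapMarks i p.1 p.2)
  refine Finset.sum_bij' (fun p _ => f p) (fun p _ => f p) ?_ ?_ ?_ ?_ ?_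
  · intro p hp
    rw [Finset.mem_filter] at hp ⊢
    exact ⟨Finset.mem_univ _, Marking.isConsInstance_of_mem_swapMarks hp.2 hi hr⟩
  · intro p hp
    rw [Finset.mem_filter] at hp ⊢
    exact ⟨Finset.mem_univ _, Marking.isConsInstance_of_mem_swapMarks hp.2 hi hr.symm⟩
  · intro p hp
    have h := (Finset.mem_filter.1 hp).2
    exact Prod.ext (Marking.swapForest_swapForest h hi hr) (Marking.swapMarks_swapMarks h hi hr)
  · intro p hp
    have h := (Finset.mem_filter.1 hp).2
    exact Prod.ext (Marking.swapForest_swapForest h hi hr.symm)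
      (Marking.swapMarks_swapMarks h hi hr.symm)
  · intro p hp
    rw [Marking.card_swapMarks (Finset.mem_filter.1 hp).2 hi hr]

namespace RForest

variable {n k : ℕ}

/-- Reverse the order of the labels. -/
def compl (F : RForest n) : RForest n where
  parent v := (F.parent v.rev).map Fin.rev
  acyclic v h := by
    refine F.acyclic v.rev (Relation.TransGen.lift (p := fun a b => F.parent b = some a) Fin.rev
      (fun a b hab => ?_) _ _ h)
    obtain ⟨c, hc, rfl⟩ := Option.map_eq_some_iff.1 hab
    rw [Function.onFun, Fin.rev_rev, hc]

lemma compl_compl (F : RForest n) : F.compl.compl = F :=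
  ext_parent <| funext fun v => by
    simp only [compl, Fin.rev_rev, Option.map_map]
    rw [show (Fin.rev ∘ Fin.rev : Fin n → Fin n) = id from funext Fin.rev_rev, Option.map_id, id]

end RForest

namespace Pattern

variable {n k : ℕ}

lemma compl_lt_compl (π : Pattern k) (a b : Fin k) : π.compl a < π.compl b ↔ π b < π a :=
  Fin.rev_lt_rev

lemma compl_compl (π : Pattern k) : π.compl.compl = π :=
  Equiv.ext fun a => Fin.rev_rev (π a)

lemma cContainsPat_compl {F : RForest n} {π : Pattern k} (h : CContainsPat F π) :
    CContainsPat F.compl π.compl := by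
  obtain ⟨v, hv⟩ := h
  refine ⟨fun j => (v j).rev, fun a b hab => ?_, fun a b => ?_⟩
  · simp only [RForest.compl, Fin.rev_rev, hv.1 a b hab, Option.map_some]
  · rw [compl_lt_compl, Fin.rev_lt_rev, hv.2]

lemma cForestWilfEquiv_compl (π : Pattern k) : CForestWilfEquiv π.compl π := by
  intro n
  have h : ∀ (π : Pattern k) (F : RForest n),
      ¬ CContainsPat F π → ¬ CContainsPat F.compl π.compl := fun π F hF hc => by
    have := cContainsPat_compl hc
    rw [F.compl_compl, π.compl_compl] at this
    exact hF this
  exact Nat.card_congr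
    { toFun := fun F => ⟨F.1.compl, by simpa only [compl_compl] using h π.compl F.1 F.2⟩
      invFun := fun F => ⟨F.1.compl, h π F.1 F.2⟩
      left_inv := fun F => Subtype.ext F.1.compl_compl
      right_inv := fun F => Subtype.ext F.1.compl_compl }

/-- The pattern with the same relative order as `f`. -/
noncomputable def ofKey (f : Fin k → ℤ) : Pattern k := (Tuple.sort f).symm

lemma ofKey_lt {f : Fin k → ℤ} (hf : Function.Injective f) (a b : Fin k) :
    ofKey f a < ofKey f b ↔ f a < f b := by
  have h : StrictMono (f ∘ Tuple.sort f) :=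
    (Tuple.monotone_sort f).strictMono_of_injective (hf.comp (Tuple.sort f).injective)
  rw [← h.lt_iff_lt]
  simp [ofKey]

/-- The key of a pattern that starts with its two smallest values and in which, from position
`3` on, each value at an odd (even) position is the smallest or largest, as prescribed by `s`,
among the values at the odd (even) positions from there on. -/
def zigzagKey (k : ℕ) (s : ℕ → Bool) (j : Fin k) : ℤ :=
  if (j : ℕ) = 0 then -10 * (k : ℤ)
  else if (j : ℕ) = 1 then -9 * (k : ℤ)
  else if (j : ℕ) = 2 then 0
  else (if (j : ℕ) % 2 = 1 then -3 * (k : ℤ) else 3 * k) + (if s j then (j : ℤ) - k else k - j)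

lemma zigzagKey_injective (s : ℕ → Bool) : Function.Injective (zigzagKey k s) := by
  intro a b h
  apply Fin.ext
  have := a.isLt
  have := b.isLt
  unfold zigzagKey at h
  split_ifs at h <;> omega

/-- The zigzag pattern of length `k` with choices `s`. -/
noncomputable def zigzag (k : ℕ) (s : ℕ → Bool) : Pattern k := ofKey (zigzagKey k s)

lemma zigzag_lt (s : ℕ → Bool) (a b : Fin k) :
    zigzag k s a < zigzag k s b ↔ zigzagKey k s a < zigzagKey k s b :=
  ofKey_lt (zigzagKey_injective s) a b

lemma isZigzag_zigzag (s : ℕ → Bool) : (zigzag k s).IsZigzag := by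
  constructor
  · intro a b ha hab
    have := Fin.lt_def.1 hab
    have := b.isLt
    rw [zigzag_lt, zigzagKey, zigzagKey]
    split_ifs <;> omega
  · intro a b ha hb hb'
    have := b.isLt
    rw [zigzag_lt, zigzagKey, zigzagKey]
    split_ifs <;> omega
  · intro a b ha hb hb'
    have := b.isLt
    rw [zigzag_lt, zigzagKey, zigzagKey]
    split_ifs <;> omega

/-- Flip the choices at the positions of the parity of `i` from `i` on. -/
def flipFrom (i : ℕ) (s : ℕ → Bool) (j : ℕ) : Bool :=
  if i ≤ j ∧ j % 2 = i % 2 then !s j else s j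

lemma zigzagKey_of_three_le {s : ℕ → Bool} {j : Fin k} (h : 3 ≤ (j : ℕ)) : zigzagKey k s j =
    (if (j : ℕ) % 2 = 1 then -3 * (k : ℤ) else 3 * k) + (if s j then (j : ℤ) - k else k - j) := by
  rw [zigzagKey, if_neg (by omega), if_neg (by omega), if_neg (by omega)]

lemma zigzagKey_lt_iff {i : ℕ} (hi : 3 ≤ i) (s t : ℕ → Bool) {a b c : Fin k}
    (ha : ¬ Alt i a) (hb : Alt i b) (hc : Alt i c) :
    (zigzagKey k s a < zigzagKey k s b ↔ zigzagKey k s a < zigzagKey k t c) ∧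
      (zigzagKey k s b < zigzagKey k s a ↔ zigzagKey k t c < zigzagKey k s a) := by
  have hrange : ∀ (s : ℕ → Bool) (d : Fin k), Alt i d → ∃ e : ℤ,
      zigzagKey k s d = (if i % 2 = 1 then -3 * (k : ℤ) else 3 * (k : ℤ)) + e ∧
        e ≤ k - i ∧ i - k ≤ e ∧ (i : ℤ) < k := by
    intro s d hd
    have := hd.1
    have := d.isLt
    refine ⟨_, by rw [zigzagKey_of_three_le (by omega), hd.2], ?_⟩
    split_ifs <;> omega
  obtain ⟨e, he, he1, he2, hik⟩ := hrange s b hb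
  obtain ⟨f, hf, hf1, hf2, -⟩ := hrange t c hc
  have ha' : (a : ℕ) < i ∨ (a : ℕ) % 2 ≠ i % 2 := by
    have : ¬ (i ≤ (a : ℕ) ∧ (a : ℕ) % 2 = i % 2) := ha
    omega
  have := a.isLt
  rw [he, hf, zigzagKey]
  clear he hf hrange ha hb hc
  rcases ha' with ha' | ha' <;> split_ifs <;> omega

lemma isReversal_flipFrom {i : ℕ} (hi : 3 ≤ i) (s : ℕ → Bool) :
    Pattern.IsReversal i (zigzag k s) (zigzag k (flipFrom i s)) where
  left := isZigzag_zigzag s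
  right := isZigzag_zigzag _
  reversed a b ha hb := by
    have ha1 := ha.1
    have hb1 := hb.1
    have ha2 := ha.2
    have hb2 := hb.2
    have := a.isLt
    have := b.isLt
    have hsa : flipFrom i s a = !s a := if_pos ha
    have hsb : flipFrom i s b = !s b := if_pos hb
    rw [zigzag_lt, zigzag_lt, zigzagKey_of_three_le (by omega), zigzagKey_of_three_le (by omega),
      zigzagKey_of_three_le (by omega), zigzagKey_of_three_le (by omega), hsa, hsb]
    cases s a <;> cases s b <;> simp only [Bool.not_true, Bool.not_false] <;> grind
  same a b hab := by
    have hkey : ∀ c : Fin k, ¬ Alt i c → zigzagKey k (flipFrom i s) c = zigzagKey k s c :=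
      fun c hc => by
        have h : flipFrom i s c = s c := if_neg hc
        rw [zigzagKey, zigzagKey, h]
    rw [zigzag_lt, zigzag_lt]
    by_cases ha : Alt i a
    · have hb : ¬ Alt i b := fun hb => hab ⟨ha, hb⟩
      rw [hkey b hb, (zigzagKey_lt_iff hi s (flipFrom i s) hb ha ha).2]
    · rw [hkey a ha]
      by_cases hb : Alt i b
      · rw [(zigzagKey_lt_iff hi s (flipFrom i s) ha hb hb).1]
      · rw [hkey b hb]
  convex a b c ha hb hc := by
    rw [zigzag_lt, zigzag_lt, (zigzagKey_lt_iff hi s s ha hb hc).1]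

lemma zigzag_congr {s t : ℕ → Bool} (h : ∀ j, 3 ≤ j → s j = t j) : zigzag k s = zigzag k t := by
  have : zigzagKey k s = zigzagKey k t := by
    funext j
    unfold zigzagKey
    split_ifs with h0 h1 h2 <;> first | rfl | grind
  rw [zigzag, this, zigzag]

lemma cForestWilfEquiv_zigzag_flipFrom {i : ℕ} (hi : 3 ≤ i) (s : ℕ → Bool) :
    CForestWilfEquiv (zigzag k s) (zigzag k (flipFrom i s)) :=
  (isReversal_flipFrom hi s).cForestWilfEquiv hi

lemma cForestWilfEquiv_zigzag_of_eq_of_ne {i : ℕ} {s t : ℕ → Bool}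
    (h : ∀ j, j ≠ i → s j = t j) : CForestWilfEquiv (zigzag k s) (zigzag k t) := by
  intro n
  by_cases hst : s i = t i
  · rw [show s = t from funext fun j => if hj : j = i then hj ▸ hst else h j hj]
  by_cases hi : 3 ≤ i
  · have hflip : flipFrom (i + 2) (flipFrom i s) = t := by
      funext j
      have := h j
      by_cases hj : j = i
      · subst hj
        simp only [flipFrom]
        cases h1 : s j <;> cases h2 : t j <;> simp_all
      · rw [← h j hj]
        simp only [flipFrom]
        split_ifs <;> first | omega | simp
    rw [cForestWilfEquiv_zigzag_flipFrom hi s n, ← hflip]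
    exact cForestWilfEquiv_zigzag_flipFrom (by omega) _ n
  · rw [zigzag_congr fun j hj => h j (by omega)]

lemma cForestWilfEquiv_zigzag (s t : ℕ → Bool) : CForestWilfEquiv (zigzag k s) (zigzag k t) := by
  have key : ∀ m, CForestWilfEquiv (zigzag k s) (zigzag k fun j => if j < m then t j else s j) := by
    intro m n
    induction m with
    | zero => simp
    | succ m ih =>
      rw [ih]
      exact cForestWilfEquiv_zigzag_of_eq_of_ne (i := m) (fun j hj => by
        by_cases hjm : j < m
        · rw [if_pos hjm, if_pos (by omega)]
        · rw [if_neg hjm, if_neg (by omega)]) n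
  intro n
  rw [key k n]
  have : zigzagKey k (fun j => if j < k then t j else s j) = zigzagKey k t :=
    funext fun j => by simp [zigzagKey, j.isLt]
  rw [zigzag, this, zigzag]

lemma zigzag_lt_add_two (s : ℕ → Bool) {a b : Fin k} (ha : 3 ≤ (a : ℕ))
    (hab : (b : ℕ) = a + 2) : zigzag k s a < zigzag k s b ↔ s a = true := by
  have := b.isLt
  rw [zigzag_lt, zigzagKey_of_three_le ha, zigzagKey_of_three_le (by omega), hab,
    Nat.add_mod_right]
  cases s a <;> simp <;> split_ifs <;> omega

/-- Extend the choices at the positions `3, …, k - 3` by `false`. -/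
def extendChoice (x : Fin (k - 5) → Bool) (j : ℕ) : Bool :=
  if h : j - 3 < k - 5 then x ⟨j - 3, h⟩ else false

/-- A zigzag pattern or the complement of a zigzag pattern. -/
noncomputable def zigzagOrCompl (k : ℕ) (x : Bool × (Fin (k - 5) → Bool)) : Pattern k :=
  if x.1 then (zigzag k (extendChoice x.2)).compl else zigzag k (extendChoice x.2)

lemma zigzagOrCompl_injective (hk : 5 ≤ k) : Function.Injective (zigzagOrCompl k) := by
  have h01 : ∀ s, zigzag k s ⟨0, by omega⟩ < zigzag k s ⟨1, by omega⟩ := fun s =>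
    (isZigzag_zigzag s).low _ _ (by simp) (by simp [Fin.lt_def])
  have hinj : ∀ x y : Fin (k - 5) → Bool,
      zigzag k (extendChoice x) = zigzag k (extendChoice y) → x = y := by
    intro x y h
    funext j
    have := j.isLt
    have hx := zigzag_lt_add_two (k := k) (extendChoice x) (a := ⟨j + 3, by omega⟩)
      (b := ⟨j + 5, by omega⟩) (by simp) (by simp)
    rw [h, zigzag_lt_add_two (k := k) (extendChoice y) (a := ⟨j + 3, by omega⟩) (by simp)
      (by simp)] at hx
    rw [Bool.eq_iff_iff]
    simpa [extendChoice] using hx.symm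
  rintro ⟨_ | _, x⟩ ⟨_ | _, y⟩ h
  · rw [hinj x y h]
  · have h1 := h01 (extendChoice x)
    rw [show zigzag k (extendChoice x) = (zigzag k (extendChoice y)).compl from h,
      compl_lt_compl] at h1
    exact absurd h1 (h01 _).not_gt
  · have h1 := h01 (extendChoice y)
    rw [show zigzag k (extendChoice y) = (zigzag k (extendChoice x)).compl from h.symm,
      compl_lt_compl] at h1
    exact absurd h1 (h01 _).not_gt
  · have h1 := congrArg compl h
    rw [hinj x y (by simpa only [zigzagOrCompl, if_true, compl_compl] using h1)]

lemma cForestWilfEquiv_zigzagOrCompl (x : Bool × (Fin (k - 5) → Bool)) (s : ℕ → Bool) :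
    CForestWilfEquiv (zigzagOrCompl k x) (zigzag k s) := by
  intro n
  rw [← cForestWilfEquiv_zigzag (extendChoice x.2) s n, zigzagOrCompl]
  split_ifs
  · exact cForestWilfEquiv_compl _ n
  · rfl

end Pattern

/-- For every `n ≥ 4` there are at least `2 ^ (n - 4)` pairwise distinct patterns of
length `n` that are pairwise c-forest-Wilf equivalent. -/
theorem exists_large_cForestWilf_class (n : ℕ) (hn : 4 ≤ n) :
    ∃ T : Finset (Pattern n), 2 ^ (n - 4) ≤ T.card ∧
      ∀ π ∈ T, ∀ π' ∈ T, CForestWilfEquiv π π' := by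
  classical
  rcases Nat.eq_or_lt_of_le hn with rfl | hn
  · refine ⟨{1}, by simp, fun π hπ π' hπ' => ?_⟩
    rw [Finset.mem_singleton] at hπ hπ'
    rw [hπ, hπ']
    exact fun _ => rfl
  · refine ⟨Finset.univ.image (Pattern.zigzagOrCompl n), ?_, fun π hπ π' hπ' m => ?_⟩
    · rw [Finset.card_image_of_injective _ (Pattern.zigzagOrCompl_injective hn), Finset.card_univ,
        Fintype.card_prod, Fintype.card_bool, Fintype.card_fun, Fintype.card_fin,
        Fintype.card_bool, ← pow_succ', show n - 5 + 1 = n - 4 by omega]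
    · obtain ⟨x, -, rfl⟩ := Finset.mem_image.1 hπ
      obtain ⟨y, -, rfl⟩ := Finset.mem_image.1 hπ'
      rw [Pattern.cForestWilfEquiv_zigzagOrCompl x (fun _ => true) m,
        Pattern.cForestWilfEquiv_zigzagOrCompl y (fun _ => true) m]
end
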